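/- arXiv:1006.4261 — 2 statements merged into one kernel-verified Lean document; each statement's English description precedes it below -/
import Mathlib

section
/- (Caffarelli) Let Ω be a bounded convex domain in ℝⁿ and let u be a convex function, continuous on the closure of Ω, twice continuously differentiable in Ω, satisfying det(D²u) = f in Ω, where f is positive, bounded away from zero, and α-Hölder continuous on Ω for some α ∈ (0,1). Assume u = 0 on ∂Ω. Then u ∈ C^{2,α}(Ω), i.e. all second-order partial derivatives of u are locally α-Hölder continuous in Ω. -/
open MeasureTheory Metric Set

noncomputable section

/-- `ℝⁿ` with its Euclidean structure. -/
abbrev Rn (n : ℕ) := EuclideanSpace ℝ (Fin n)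

/-- Second derivative of `u` at `z` in the directions `v, w`. -/
def D2 {n : ℕ} (u : Rn n → ℝ) (z v w : Rn n) : ℝ := fderiv ℝ (fderiv ℝ u) z v w

/-- The real Hessian matrix `D²u = (∂²u/∂x_i∂x_j)`. -/
def realHessian {n : ℕ} (u : Rn n → ℝ) (z : Rn n) : Matrix (Fin n) (Fin n) ℝ := fun i j =>
  D2 u z (EuclideanSpace.single i 1) (EuclideanSpace.single j 1)

namespace MongeAmpere

section

open scoped FourierTransform ContDiff
open Real Complex

variable {n : ℕ}

/-- Derivative of `f` in the direction `v`. -/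
def dd {F : Type*} [NormedAddCommGroup F] [NormedSpace ℝ F] (v : Rn n) (f : Rn n → F) (x : Rn n) :
    F := fderiv ℝ f x v

/-- The standard basis vectors of `Rn n`. -/
def stdVec (i : Fin n) : Rn n := EuclideanSpace.single i 1

/-- The constant coefficient operator `w ↦ ∑ a i j ∂ᵢ∂ⱼ w`. -/
def ellOp (a : Matrix (Fin n) (Fin n) ℝ) (w : Rn n → ℝ) (x : Rn n) : ℝ :=
  ∑ i, ∑ j, a i j * dd (stdVec i) (dd (stdVec j) w) x

/-- The quadratic form `∑ a i j ξᵢ ξⱼ`. -/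
def quadForm (a : Matrix (Fin n) (Fin n) ℝ) (ξ : Rn n) : ℝ :=
  ∑ i, ∑ j, a i j * (ξ i * ξ j)

lemma inner_stdVec (ξ : Rn n) (i : Fin n) : inner ℝ ξ (stdVec i) = ξ i := by
  simp [stdVec, EuclideanSpace.inner_single_right]

lemma dd_fourier (v : Rn n) {f : Rn n → ℂ} (hf : Integrable f)
    (hvf : Integrable (fun v ↦ ‖v‖ * ‖f v‖)) :
    dd v (𝓕 f) = 𝓕 (fun ξ : Rn n => (-(2 * π * I) * ((inner ℝ ξ v : ℝ) : ℂ) * f ξ : ℂ)) := by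
  funext x
  have h1 : Integrable (VectorFourier.fourierSMulRight (innerSL ℝ) f) := by
    refine (hvf.const_mul (2 * π * ‖innerSL ℝ (E := Rn n)‖)).mono'
      hf.aestronglyMeasurable.fourierSMulRight (Filter.Eventually.of_forall fun x => ?_)
    have := VectorFourier.norm_fourierSMulRight_le (innerSL ℝ (E := Rn n)) f x
    linarith
  rw [dd, Real.fderiv_fourier hf hvf,
    Real.fourier_continuousLinearMap_apply h1]
  refine congrFun (congrArg _ ?_) x
  funext ξ
  simp [VectorFourier.fourierSMulRight_apply, innerSL_apply_apply ℝ]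
  ring

lemma dd_dd_fourier (v w : Rn n) {f : Rn n → ℂ}
    (hf : ∀ k : ℕ, Integrable (fun v ↦ ‖v‖ ^ k * ‖f v‖)) (hm : AEStronglyMeasurable f) :
    dd v (dd w (𝓕 f)) =
      𝓕 (fun ξ : Rn n => (-(4 * π ^ 2) * ((inner ℝ ξ v * inner ℝ ξ w : ℝ) : ℂ) * f ξ : ℂ)) := by
  have h0 : Integrable f := (hf 0).mono' hm (by simp)
  have hm' : AEStronglyMeasurable
      (fun ξ : Rn n => -(2 * π * I) * ((inner ℝ ξ w : ℝ) : ℂ) * f ξ) :=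
    AEStronglyMeasurable.mul (Continuous.aestronglyMeasurable (by fun_prop)) hm
  have hb : ∀ ξ : Rn n, ‖-(2 * π * I) * ((inner ℝ ξ w : ℝ) : ℂ) * f ξ‖ ≤
      (2 * π * ‖w‖) * (‖ξ‖ * ‖f ξ‖) := by
    intro ξ
    have := abs_real_inner_le_norm ξ w
    simp only [norm_mul, norm_neg, Complex.norm_real, Real.norm_eq_abs, abs_of_pos Real.pi_pos,
      Complex.norm_I, Complex.norm_ofNat]
    have := mul_le_mul_of_nonneg_right this (by positivity : 0 ≤ 2 * π * ‖f ξ‖)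
    linarith
  rw [dd_fourier w h0 (by simpa using hf 1), dd_fourier]
  · congr 1
    funext ξ
    have := Complex.I_sq
    push_cast
    linear_combination (4 * π^2 * ((inner ℝ ξ v : ℝ) : ℂ) * ((inner ℝ ξ w : ℝ) : ℂ) * f ξ) * this
  · refine ((hf 1).const_mul (2 * π * ‖w‖)).mono' hm' (Filter.Eventually.of_forall fun ξ => ?_)
    simpa using hb ξ
  · refine ((hf 2).const_mul (2 * π * ‖w‖)).mono' ?_ (Filter.Eventually.of_forall fun ξ => ?_)
    · exact AEStronglyMeasurable.mul (Continuous.aestronglyMeasurable (by fun_prop)) hm'.norm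
    · rw [norm_mul, norm_norm, norm_norm]
      have := mul_le_mul_of_nonneg_left (hb ξ) (norm_nonneg ξ)
      calc _ ≤ _ := this
        _ = _ := by ring

lemma dd_re (v : Rn n) {f : Rn n → ℂ} (hf : Differentiable ℝ f) :
    dd v (fun x => (f x).re) = fun x => (dd v f x).re := by
  funext x
  have := (Complex.reCLM.hasFDerivAt.comp x (hf x).hasFDerivAt).fderiv
  simp only [dd]
  have h2 : (fun x => (f x).re) = Complex.reCLM ∘ f := rfl
  rw [h2, this]
  simp

lemma contDiff_dd {F : Type*} [NormedAddCommGroup F] [NormedSpace ℝ F] {k : ℕ∞} (v : Rn n)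
    {f : Rn n → F} (hf : ContDiff ℝ (k + 1) f) : ContDiff ℝ k (dd v f) :=
  (hf.fderiv_right (m := k) le_rfl).clm_apply contDiff_const

lemma norm_sq_integral_mul_le {f g : Rn n → ℂ} (hf : MemLp f 2) (hg : MemLp g 2) :
    ‖∫ x, f x * g x‖ ^ 2 ≤ (∫ x, ‖f x‖ ^ 2) * ∫ x, ‖g x‖ ^ 2 := by
  have h1 : ‖∫ x, f x * g x‖ ≤ ∫ x, ‖f x‖ * ‖g x‖ := by
    refine (norm_integral_le_integral_norm _).trans (le_of_eq ?_)
    simp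
  have h2 := integral_mul_norm_le_Lp_mul_Lq (μ := volume) (f := f) (g := g)
    Real.HolderConjugate.two_two (by simpa using hf) (by simpa using hg)
  have h3 := h1.trans h2
  have hA : 0 ≤ ∫ x, ‖f x‖ ^ 2 := integral_nonneg fun x => by positivity
  have hB : 0 ≤ ∫ x, ‖g x‖ ^ 2 := integral_nonneg fun x => by positivity
  simp only [Real.rpow_two, ← Real.sqrt_eq_rpow] at h3
  calc _ ≤ (√(∫ x, ‖f x‖ ^ 2) * √(∫ x, ‖g x‖ ^ 2)) ^ 2 := by gcongr
    _ = _ := by rw [mul_pow, Real.sq_sqrt hA, Real.sq_sqrt hB]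

lemma integrableOn_ball_of_continuous {f : Rn n → ℝ} (hf : Continuous f) (z : Rn n) (R : ℝ) :
    IntegrableOn f (ball z R) :=
  (hf.continuousOn.integrableOn_compact (isCompact_closedBall z R)).mono_set ball_subset_closedBall

/-- A local form of the Plancherel inequality for integrable square integrable functions. -/
lemma setIntegral_norm_sq_fourier_le {f : Rn n → ℂ} (hf : Integrable f) (hf2 : MemLp f 2)
    (hp : ContDiff ℝ ∞ (𝓕 f)) (z : Rn n) (R : ℝ) :
    ∫ x in ball z R, ‖𝓕 f x‖ ^ 2 ≤ ∫ x, ‖f x‖ ^ 2 := by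
  rcases le_or_gt R 0 with hR | hR
  · rw [ball_eq_empty.2 hR]; simp; exact integral_nonneg fun x => by positivity
  let χ : ContDiffBump z := ⟨R, R + 1, hR, by linarith⟩
  have hχc : HasCompactSupport χ := χ.hasCompactSupport
  let θ : Rn n → ℂ := fun x => (starRingEnd ℂ) (𝓕 f x) * (χ x : ℂ)
  have hθ : ContDiff ℝ ∞ θ := by
    refine ContDiff.mul (Complex.conjCLE.contDiff.comp hp) ?_
    exact Complex.ofRealCLM.contDiff.comp χ.contDiff
  have hθc : HasCompactSupport θ := by
    refine HasCompactSupport.mul_left ?_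
    exact hχc.comp_left (g := fun t : ℝ => (t : ℂ)) (by simp)
  let Θ := hθc.toSchwartzMap hθ
  have hΘ : ∀ x, Θ x = θ x := fun x => rfl
  have e1 : ∫ x, 𝓕 f x * θ x = ∫ ξ, f ξ * (𝓕 Θ) ξ := by
    have := VectorFourier.integral_fourierIntegral_smul_eq_flip (L := innerₗ (Rn n)) (μ := volume)
      (ν := volume) continuous_fourierChar continuous_inner hf Θ.integrable
    simpa using! this
  have e2 : ∫ ξ, ‖(𝓕 Θ) ξ‖ ^ 2 = ∫ x, ‖θ x‖ ^ 2 := Θ.integral_norm_sq_fourier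
  have e3 : ∫ x, 𝓕 f x * θ x = ((∫ x, ‖𝓕 f x‖ ^ 2 * χ x : ℝ) : ℂ) := by
    rw [← integral_complex_ofReal]
    congr 1; funext x
    simp only [θ]
    rw [← mul_assoc, Complex.mul_conj, Complex.normSq_eq_norm_sq]
    push_cast; rfl
  have hcont : Continuous (𝓕 f) := hp.continuous
  have i1 : Integrable (fun x => ‖𝓕 f x‖ ^ 2 * χ x) :=
    Continuous.integrable_of_hasCompactSupport (by have := χ.continuous; fun_prop) hχc.mul_left
  have e4 : ∫ x, ‖θ x‖ ^ 2 ≤ ∫ x, ‖𝓕 f x‖ ^ 2 * χ x := by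
    refine integral_mono_of_nonneg (Filter.Eventually.of_forall fun x => by positivity) i1
      (Filter.Eventually.of_forall fun x => ?_)
    simp only [θ, norm_mul, RCLike.norm_conj, Complex.norm_real, Real.norm_eq_abs,
      abs_of_nonneg χ.nonneg, mul_pow]
    have h1 := χ.nonneg (x := x)
    have h2 := χ.le_one (x := x)
    gcongr
    nlinarith
  have e5 := norm_sq_integral_mul_le hf2 ((𝓕 Θ).memLp 2)
  rw [← e1, e2, e3, Complex.norm_real, Real.norm_eq_abs, sq_abs] at e5
  set I0 := ∫ x, ‖𝓕 f x‖ ^ 2 * χ x with hI0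
  have hA : 0 ≤ ∫ x, ‖f x‖ ^ 2 := integral_nonneg fun x => by positivity
  have hI0' : 0 ≤ I0 := integral_nonneg fun x => mul_nonneg (by positivity) χ.nonneg
  have e6 : I0 ≤ ∫ x, ‖f x‖ ^ 2 := by
    have := e5.trans (mul_le_mul_of_nonneg_left e4 hA)
    by_contra! hlt
    nlinarith
  refine le_trans ?_ e6
  have i2 : IntegrableOn (fun x => ‖𝓕 f x‖ ^ 2 * χ x) (ball z R) := i1.integrableOn
  calc ∫ x in ball z R, ‖𝓕 f x‖ ^ 2 = ∫ x in ball z R, ‖𝓕 f x‖ ^ 2 * χ x := by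
        refine setIntegral_congr_fun measurableSet_ball fun x hx => ?_
        have : χ x = 1 := χ.one_of_mem_closedBall (ball_subset_closedBall hx)
        simp [this]
    _ ≤ I0 := setIntegral_le_integral i1
        (Filter.Eventually.of_forall fun x => mul_nonneg (by positivity) χ.nonneg)

end

section

open scoped FourierTransform ContDiff
open Real Complex

variable {n : ℕ}

/-- For `G` smooth with compact support, there is a function `p` with `L p = ∂ᵥ∂ᵥ' G`, whose `L²`
norm is controlled by that of `G`. -/
lemma exists_potential (a : Matrix (Fin n) (Fin n) ℝ) {lam : ℝ} (hlam : 0 < lam)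
    (ha : ∀ ξ : Rn n, lam * ‖ξ‖ ^ 2 ≤ quadForm a ξ) (v v' : Rn n) (hv : ‖v‖ ≤ 1) (hv' : ‖v'‖ ≤ 1)
    {G : Rn n → ℝ} (hG : ContDiff ℝ ∞ G) (hGc : HasCompactSupport G) :
    ∃ p : Rn n → ℝ, ContDiff ℝ ∞ p ∧ (∀ x, ellOp a p x = dd v (dd v' G) x) ∧
      ∀ z R, ∫ x in ball z R, p x ^ 2 ≤ (1 / lam) ^ 2 * ∫ x, G x ^ 2 := by
  let Gc : Rn n → ℂ := fun x => (G x : ℂ)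
  have hGc1 : ContDiff ℝ ∞ Gc := Complex.ofRealCLM.contDiff.comp hG
  have hGc2 : HasCompactSupport Gc := hGc.comp_left (g := fun t : ℝ => (t : ℂ)) (by simp)
  let S := hGc2.toSchwartzMap hGc1
  let T := 𝓕⁻ S
  let m : Rn n → ℝ := fun ξ => inner ℝ ξ v * inner ℝ ξ v' / quadForm a ξ
  have hq : Continuous (quadForm a) := by unfold quadForm; fun_prop
  have hm_meas : Measurable m := by
    refine Measurable.div (Continuous.measurable (by fun_prop)) hq.measurable
  have hm_bd : ∀ ξ, |m ξ| ≤ 1 / lam := by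
    intro ξ
    rcases eq_or_ne ξ 0 with rfl | hξ
    · simp [m]; positivity
    · have hpos : 0 < ‖ξ‖ := norm_pos_iff.2 hξ
      have h0 : 0 < lam * ‖ξ‖ ^ 2 := by positivity
      have hqpos : 0 < quadForm a ξ := h0.trans_le (ha ξ)
      have h1 := (abs_real_inner_le_norm ξ v).trans (mul_le_of_le_one_right hpos.le hv)
      have h2 := (abs_real_inner_le_norm ξ v').trans (mul_le_of_le_one_right hpos.le hv')
      simp only [m]
      rw [abs_div, abs_mul, abs_of_pos hqpos, div_le_div_iff₀ hqpos hlam]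
      have h3 := mul_le_mul h1 h2 (abs_nonneg _) hpos.le
      have := mul_le_mul_of_nonneg_right h3 hlam.le
      linarith [ha ξ]
  have hqm : ∀ ξ, quadForm a ξ * m ξ = inner ℝ ξ v * inner ℝ ξ v' := by
    intro ξ
    rcases eq_or_ne ξ 0 with rfl | hξ
    · simp [m]
    · have hpos : 0 < ‖ξ‖ := norm_pos_iff.2 hξ
      have h0 : 0 < lam * ‖ξ‖ ^ 2 := by positivity
      have hqpos : 0 < quadForm a ξ := h0.trans_le (ha ξ)
      simp only [m]
      field_simp
  let F : Rn n → ℂ := fun ξ => (m ξ : ℂ) * T ξ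
  have hFm : AEStronglyMeasurable F := by
    refine AEStronglyMeasurable.mul ?_ T.continuous.aestronglyMeasurable
    exact (Complex.measurable_ofReal.comp hm_meas).aestronglyMeasurable
  have hFle : ∀ ξ, ‖F ξ‖ ≤ (1 / lam) * ‖T ξ‖ := by
    intro ξ
    simp only [F, norm_mul, Complex.norm_real, Real.norm_eq_abs]
    exact mul_le_mul_of_nonneg_right (hm_bd ξ) (norm_nonneg _)
  have hTk : ∀ k : ℕ, Integrable (fun ξ => ‖ξ‖ ^ k * ‖T ξ‖) := fun k =>
    T.integrable_pow_mul volume k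
  have hFk : ∀ k : ℕ, Integrable (fun ξ => ‖ξ‖ ^ k * ‖F ξ‖) := by
    intro k
    refine ((hTk k).const_mul (1 / lam)).mono' ?_ (Filter.Eventually.of_forall fun ξ => ?_)
    · exact AEStronglyMeasurable.mul (Continuous.aestronglyMeasurable (by fun_prop)) hFm.norm
    · rw [norm_mul, norm_norm, norm_pow, norm_norm]
      calc _ ≤ ‖ξ‖ ^ k * ((1 / lam) * ‖T ξ‖) := by gcongr; exact hFle ξ
        _ = _ := by ring
  have hF1 : Integrable F := (hFk 0).mono' hFm (by simp)
  have hF2 : MemLp F 2 := (T.memLp 2).of_le_mul hFm (Filter.Eventually.of_forall hFle)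
  have hP : ContDiff ℝ ∞ (𝓕 F) := by
    have := Real.contDiff_fourier (f := F) (N := ⊤) (fun k _ => hFk k)
    exact this
  have hfT : ∀ x, 𝓕 (T : Rn n → ℂ) x = Gc x := by
    intro x
    have : 𝓕 T = S := FourierTransform.fourier_fourierInv_eq S
    rw [← SchwartzMap.fourier_coe, this]; rfl
  have hfT' : 𝓕 (T : Rn n → ℂ) = Gc := funext hfT
  have hre : ∀ (w w' : Rn n) {f : Rn n → ℂ}, ContDiff ℝ ∞ f →
      dd w (dd w' fun x => (f x).re) = fun x => (dd w (dd w' f) x).re := by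
    intro w w' f hf
    have hd : ContDiff ℝ ∞ (dd w' f) := contDiff_dd (k := ⊤) w' hf
    rw [dd_re w' (hf.differentiable (by simp)), dd_re w (hd.differentiable (by simp))]
  refine ⟨fun x => (𝓕 F x).re, Complex.reCLM.contDiff.comp hP, fun x => ?_, fun z R => ?_⟩
  · have e1 : ellOp a (fun x => (𝓕 F x).re) x =
        (∑ i, ∑ j, (a i j : ℂ) * dd (stdVec i) (dd (stdVec j) (𝓕 F)) x).re := by
      simp only [ellOp, Complex.re_sum, hre _ _ hP, Complex.re_ofReal_mul]
    have e2 : G = fun x => (Gc x).re := by funext x; simp [Gc]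
    rw [e1, e2, hre _ _ hGc1, ← hfT', dd_dd_fourier v v' hTk T.continuous.aestronglyMeasurable]
    congr 1
    simp only [dd_dd_fourier _ _ hFk hFm, inner_stdVec]
    have hInt : ∀ i j : Fin n, Integrable (fun ξ : Rn n =>
        (-(4 * π ^ 2) * ((ξ i * ξ j : ℝ) : ℂ) * F ξ : ℂ)) := by
      intro i j
      refine ((hFk 2).const_mul (4 * π ^ 2)).mono' ?_ (Filter.Eventually.of_forall fun ξ => ?_)
      · exact AEStronglyMeasurable.mul (Continuous.aestronglyMeasurable (by fun_prop)) hFm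
      · simp only [norm_mul, norm_neg, norm_pow, Complex.norm_real, Real.norm_eq_abs,
          abs_of_pos Real.pi_pos, Complex.norm_ofNat]
        have h1 : |ξ i| ≤ ‖ξ‖ := PiLp.norm_apply_le ξ i
        have h2 : |ξ j| ≤ ‖ξ‖ := PiLp.norm_apply_le ξ j
        calc _ ≤ 4 * π ^ 2 * (‖ξ‖ * ‖ξ‖) * ‖F ξ‖ := by gcongr
          _ = _ := by ring
    simp only [Real.fourier_eq]
    simp_rw [← integral_const_mul]
    have hInt' : ∀ i j : Fin n, Integrable (fun ξ : Rn n => (a i j : ℂ) *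
        (𝐞 (-inner ℝ ξ x) • (-(4 * π ^ 2) * ((ξ i * ξ j : ℝ) : ℂ) * F ξ : ℂ))) := fun i j =>
      ((Real.fourierIntegral_convergent_iff x).2 (hInt i j)).const_mul _
    have hs : ∀ i, ∑ j, ∫ ξ, (a i j : ℂ) *
        (𝐞 (-inner ℝ ξ x) • (-(4 * π ^ 2) * ((ξ i * ξ j : ℝ) : ℂ) * F ξ : ℂ)) =
        ∫ ξ, ∑ j, (a i j : ℂ) *
        (𝐞 (-inner ℝ ξ x) • (-(4 * π ^ 2) * ((ξ i * ξ j : ℝ) : ℂ) * F ξ : ℂ)) := fun i =>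
      (integral_finsetSum _ fun j _ => hInt' i j).symm
    simp_rw [hs]
    rw [← integral_finsetSum _ fun i _ => integrable_finsetSum _ fun j _ => hInt' i j]
    congr 1
    funext ξ
    have h3 : ((inner ℝ ξ v * inner ℝ ξ v' : ℝ) : ℂ) = ((quadForm a ξ * m ξ : ℝ) : ℂ) := by
      rw [hqm]
    rw [h3]
    simp only [F, quadForm, Circle.smul_def, smul_eq_mul]
    push_cast
    simp only [Finset.mul_sum, Finset.sum_mul]
    refine Finset.sum_congr rfl fun i _ => Finset.sum_congr rfl fun j _ => ?_
    ring
  · have h1 := setIntegral_norm_sq_fourier_le hF1 hF2 hP z R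
    have h2 : ∫ x, ‖F x‖ ^ 2 ≤ ∫ x, (1 / lam) ^ 2 * ‖T x‖ ^ 2 := by
      refine integral_mono_of_nonneg (Filter.Eventually.of_forall fun x => by positivity) ?_
        (Filter.Eventually.of_forall fun x => ?_)
      · exact ((T.memLp 2).integrable_norm_pow (by simp)).const_mul _
      · have := hFle x
        calc ‖F x‖ ^ 2 ≤ ((1 / lam) * ‖T x‖) ^ 2 := by gcongr
          _ = _ := by ring
    have h3 : ∫ x, ‖T x‖ ^ 2 = ∫ x, G x ^ 2 := by
      rw [← SchwartzMap.integral_norm_sq_fourier T]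
      congr 1; funext x
      rw [SchwartzMap.fourier_coe, hfT]; simp [Gc]
    have h4 : ∫ x in ball z R, (𝓕 F x).re ^ 2 ≤ ∫ x in ball z R, ‖𝓕 F x‖ ^ 2 := by
      have hc := hP.continuous
      refine integral_mono_of_nonneg (Filter.Eventually.of_forall fun x => by positivity) ?_
        (Filter.Eventually.of_forall fun x => ?_)
      · exact integrableOn_ball_of_continuous (by fun_prop) z R
      · have := Complex.abs_re_le_norm (𝓕 F x)
        calc (𝓕 F x).re ^ 2 = |(𝓕 F x).re| ^ 2 := (sq_abs _).symm
          _ ≤ ‖𝓕 F x‖ ^ 2 := by gcongr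
    rw [integral_const_mul, h3] at h2
    exact h4.trans (h1.trans h2)

end

section

open scoped ContDiff

variable {n : ℕ}

lemma stdVec_apply (i j : Fin n) : stdVec i j = if j = i then 1 else 0 := by
  simp [stdVec]

lemma fderiv_quadForm_stdVec (B : Matrix (Fin n) (Fin n) ℝ) (hB : ∀ i j, B i j = B j i)
    (y : Rn n) (i : Fin n) :
    HasFDerivAt (quadForm B) (fderiv ℝ (quadForm B) y) y ∧
      fderiv ℝ (quadForm B) y (stdVec i) = 2 * ∑ k, B i k * y k := by
  have hp : ∀ k : Fin n, HasFDerivAt (fun y : Rn n => y k)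
      (EuclideanSpace.proj k : Rn n →L[ℝ] ℝ) y := fun k =>
    (EuclideanSpace.proj k : Rn n →L[ℝ] ℝ).hasFDerivAt
  have h : HasFDerivAt (quadForm B) (∑ k, ∑ l, B k l •
      (y k • (EuclideanSpace.proj l : Rn n →L[ℝ] ℝ) + y l • (EuclideanSpace.proj k))) y :=
    HasFDerivAt.fun_sum fun k _ => HasFDerivAt.fun_sum fun l _ =>
      ((hp k).mul (hp l)).const_mul (B k l)
  rw [h.fderiv]
  refine ⟨h, ?_⟩
  have hproj : ∀ l, (EuclideanSpace.proj l : Rn n →L[ℝ] ℝ) (stdVec i) = if l = i then 1 else 0 :=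
    fun l => stdVec_apply i l
  simp only [sum_apply, smul_apply, add_apply, hproj, smul_eq_mul]
  simp only [mul_add, mul_ite, mul_one, mul_zero, Finset.sum_add_distrib, Finset.sum_ite_eq',
    Finset.mem_univ, if_true]
  have e1 : ∑ k, ∑ l, (if k = i then B k l * y l else 0) = ∑ l, B i l * y l := by
    rw [Finset.sum_eq_single i] <;> simp +contextual
  rw [e1, two_mul]
  congr 1
  exact Finset.sum_congr rfl fun k _ => by rw [hB]

/-- A compactly supported kernel satisfying the identity behind the mean value property of the
operator `ellOp a`. -/
lemma exists_meanValue_kernel (a B : Matrix (Fin n) (Fin n) ℝ) (hB : ∀ i j, B i j = B j i)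
    (haB : ∀ j k, ∑ i, a i j * B i k = if j = k then 1 else 0) {μ : ℝ} (hμ : 0 < μ)
    (hBμ : ∀ y : Rn n, μ * ‖y‖ ^ 2 ≤ quadForm B y) :
    ∃ φ ψ : Rn n → ℝ, ContDiff ℝ ∞ φ ∧ ContDiff ℝ ∞ ψ ∧
      (∀ y, 1 ≤ ‖y‖ → φ y = 0) ∧ (∀ y, 1 ≤ ‖y‖ → ψ y = 0) ∧ ∫ y, φ y = 1 ∧
      ∀ y j, ∑ i, a i j * dd (stdVec i) ψ y = -(φ y * y j) := by
  have hE : ContDiff ℝ ∞ expNegInvGlue := expNegInvGlue.contDiff (n := ⊤)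
  have hE' : ContDiff ℝ ∞ (deriv expNegInvGlue) :=
    ((contDiff_succ_iff_deriv (n := ∞)).1 hE).2.2
  have hQ : ContDiff ℝ ∞ (quadForm B) := by
    unfold quadForm
    fun_prop
  let ψ₀ : Rn n → ℝ := fun y => expNegInvGlue (1 - quadForm B y / μ)
  let φ₀ : Rn n → ℝ := fun y => 2 / μ * deriv expNegInvGlue (1 - quadForm B y / μ)
  have harg : ContDiff ℝ ∞ (fun y : Rn n => 1 - quadForm B y / μ) :=
    contDiff_const.sub (hQ.div_const _)
  have hψ : ContDiff ℝ ∞ ψ₀ := hE.comp harg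
  have hφ : ContDiff ℝ ∞ φ₀ := contDiff_const.mul (hE'.comp harg)
  have hout : ∀ y : Rn n, 1 ≤ ‖y‖ → 1 - quadForm B y / μ ≤ 0 := by
    intro y hy
    rw [sub_nonpos, le_div_iff₀ hμ]
    have := hBμ y
    have : (1 : ℝ) ≤ ‖y‖ ^ 2 := by nlinarith
    nlinarith
  have hd0 : ∀ t ≤ (0 : ℝ), deriv expNegInvGlue t = 0 := by
    intro t ht
    have h1 : IsLocalMin expNegInvGlue t := by
      refine Filter.Eventually.of_forall fun s => ?_
      rw [expNegInvGlue.zero_of_nonpos ht]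
      exact expNegInvGlue.nonneg s
    exact h1.deriv_eq_zero
  have hψ0 : ∀ y : Rn n, 1 ≤ ‖y‖ → ψ₀ y = 0 := fun y hy =>
    expNegInvGlue.zero_of_nonpos (hout y hy)
  have hφ0 : ∀ y : Rn n, 1 ≤ ‖y‖ → φ₀ y = 0 := fun y hy => by
    simp only [φ₀]; rw [hd0 _ (hout y hy), mul_zero]
  have hφc : HasCompactSupport φ₀ := HasCompactSupport.intro (isCompact_closedBall (0 : Rn n) 1)
    fun y hy => hφ0 y (by simpa using (not_le.1 (by simpa using hy) : 1 < ‖y‖).le)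
  have hφnn : 0 ≤ φ₀ := fun y => mul_nonneg (by positivity) expNegInvGlue.monotone.deriv_nonneg
  have hφne : φ₀ 0 ≠ 0 := by
    have h1 : HasDerivAt expNegInvGlue (Real.exp (-1)) 1 := by
      have h2 : HasDerivAt (fun x : ℝ => Real.exp (-x⁻¹)) (Real.exp (-1)) 1 := by
        have := ((hasDerivAt_inv (one_ne_zero (α := ℝ))).neg).exp
        simpa using this
      refine h2.congr_of_eventuallyEq ?_
      filter_upwards [lt_mem_nhds (zero_lt_one (α := ℝ))] with x hx
      simp [expNegInvGlue, not_le.2 hx]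
    have h3 : quadForm B 0 = 0 := by simp [quadForm]
    simp only [φ₀, h3, zero_div, sub_zero, h1.deriv]
    positivity
  have hI : 0 < ∫ y, φ₀ y :=
    hφ.continuous.integral_pos_of_hasCompactSupport_nonneg_nonzero hφc hφnn hφne
  set c := ∫ y, φ₀ y with hc
  refine ⟨fun y => c⁻¹ * φ₀ y, fun y => c⁻¹ * ψ₀ y, contDiff_const.mul hφ, contDiff_const.mul hψ,
    fun y hy => by simp [hφ0 y hy], fun y hy => by simp [hψ0 y hy], ?_, fun y j => ?_⟩
  · rw [integral_const_mul, ← hc, inv_mul_cancel₀ hI.ne']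
  · have hdψ : ∀ i, dd (stdVec i) (fun y => c⁻¹ * ψ₀ y) y =
        -(c⁻¹ * φ₀ y) * ∑ k, B i k * y k := by
      intro i
      obtain ⟨h1, h2⟩ := fderiv_quadForm_stdVec B hB y i
      have h3 := ((hE.differentiable (by simp)) (1 - quadForm B y / μ)).hasDerivAt
      have h4 : HasFDerivAt (fun y => 1 - quadForm B y / μ)
          (-(μ⁻¹ • fderiv ℝ (quadForm B) y)) y := by
        have := (h1.const_mul μ⁻¹).const_sub 1
        refine this.congr_of_eventuallyEq (Filter.Eventually.of_forall fun z => ?_)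
        simp only [div_eq_inv_mul]
      have h5 := (h3.comp_hasFDerivAt y h4).const_mul c⁻¹
      have h6 := h5.fderiv
      simp only [Function.comp_def] at h6
      simp only [dd, ψ₀, φ₀]
      rw [h6]
      simp only [smul_apply, neg_apply, h2, smul_eq_mul]
      ring
    simp only [hdψ]
    have e : ∀ i, a i j * (-(c⁻¹ * φ₀ y) * ∑ k, B i k * y k) =
        ∑ k, -(c⁻¹ * φ₀ y) * y k * (a i j * B i k) := by
      intro i
      simp only [Finset.mul_sum]
      exact Finset.sum_congr rfl fun k _ => by ring
    simp only [e]
    rw [Finset.sum_comm]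
    simp only [← Finset.mul_sum, haB]
    simp

lemma dd_comp_affine {F : Type*} [NormedAddCommGroup F] [NormedSpace ℝ F] (v x : Rn n) (t : ℝ)
    {f : Rn n → F} (hf : Differentiable ℝ f) (y : Rn n) :
    dd v (fun y => f (x + t • y)) y = t • dd v f (x + t • y) := by
  have h : HasFDerivAt (fun y : Rn n => x + t • y) (t • ContinuousLinearMap.id ℝ (Rn n)) y :=
    ((hasFDerivAt_id y).const_smul t).const_add x
  have h2 := ((hf (x + t • y)).hasFDerivAt.comp y h).fderiv
  simp only [Function.comp_def] at h2
  simp [dd, h2]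

lemma sum_smul_stdVec (y : Rn n) : ∑ i, y i • stdVec i = y := by
  ext j
  simp [stdVec_apply]

lemma integral_mul_dd_eq {ψ g : Rn n → ℝ} (v : Rn n) (hψ : ContDiff ℝ 1 ψ)
    (hψc : HasCompactSupport ψ) (hg : ContDiff ℝ 1 g) :
    ∫ y, dd v ψ y * g y = -∫ y, ψ y * dd v g y := by
  have h1 : Continuous (dd v ψ) := (contDiff_dd (k := 0) v (by simpa using hψ)).continuous
  have h2 : Continuous (dd v g) := (contDiff_dd (k := 0) v (by simpa using hg)).continuous
  have hc : HasCompactSupport (dd v ψ) := hψc.fderiv_apply (𝕜 := ℝ) v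
  have hψ' := hψ.continuous
  have hg' := hg.continuous
  have := integral_mul_fderiv_eq_neg_fderiv_mul_of_integrable (μ := volume) (f := ψ) (g := g)
    (v := v)
    (Continuous.integrable_of_hasCompactSupport (h1.mul hg') hc.mul_right)
    (Continuous.integrable_of_hasCompactSupport (hψ'.mul h2) hψc.mul_right)
    (Continuous.integrable_of_hasCompactSupport (hψ'.mul hg') hψc.mul_right)
    (fun x _ => (hψ.differentiable (by simp)) x) (fun x _ => (hg.differentiable (by simp)) x)
  simp only [dd]
  rw [this, neg_neg]

/-- The mean value property for solutions of `ellOp a H = 0`. -/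
lemma meanValue_eq (a : Matrix (Fin n) (Fin n) ℝ) {φ ψ : Rn n → ℝ}
    (hφ : ContDiff ℝ ∞ φ) (hψ : ContDiff ℝ ∞ ψ) (hφ0 : ∀ y, 1 ≤ ‖y‖ → φ y = 0)
    (hψ0 : ∀ y, 1 ≤ ‖y‖ → ψ y = 0) (hφ1 : ∫ y, φ y = 1)
    (hker : ∀ y j, ∑ i, a i j * dd (stdVec i) ψ y = -(φ y * y j))
    {H : Rn n → ℝ} (hH : ContDiff ℝ 2 H) {x : Rn n} {s : ℝ} (hs : 0 ≤ s)
    (hLH : ∀ y ∈ ball x s, ellOp a H y = 0) :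
    ∫ y, φ y * H (x + s • y) = H x := by
  have hcs : ∀ {χ : Rn n → ℝ}, (∀ y, 1 ≤ ‖y‖ → χ y = 0) → HasCompactSupport χ := fun h =>
    HasCompactSupport.intro (isCompact_closedBall (0 : Rn n) 1)
      fun y hy => h y (by simpa using (not_le.1 (by simpa using hy) : 1 < ‖y‖).le)
  have hφc := hcs hφ0
  have hψc := hcs hψ0
  have hφC := hφ.continuous
  have hHC := hH.continuous
  have hH1 : ContDiff ℝ 1 (fderiv ℝ H) := hH.fderiv_right (m := 1) (by norm_num)
  have hH1C := hH1.continuous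
  have hderiv : ∀ t : ℝ, HasDerivAt (fun t => ∫ y, φ y * H (x + t • y))
      (∫ y, φ y * fderiv ℝ H (x + t • y) y) t := by
    intro t
    obtain ⟨C, hC⟩ := (isCompact_closedBall x (|t| + 1)).exists_bound_of_continuousOn
      hH1C.continuousOn
    refine (hasDerivAt_integral_of_dominated_loc_of_deriv_le (bound := fun y => |φ y| * |C|)
      (F := fun t y => φ y * H (x + t • y)) (F' := fun t y => φ y * fderiv ℝ H (x + t • y) y)
      (ball_mem_nhds t one_pos) (Filter.Eventually.of_forall fun t' => ?_) ?_ ?_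
      (Filter.Eventually.of_forall fun y t' ht' => ?_) ?_
      (Filter.Eventually.of_forall fun y t' _ => ?_)).2
    · exact Continuous.aestronglyMeasurable (by fun_prop)
    · exact Continuous.integrable_of_hasCompactSupport (by fun_prop) hφc.mul_right
    · exact Continuous.aestronglyMeasurable (by fun_prop)
    · rcases le_or_gt 1 ‖y‖ with hy | hy
      · simp [hφ0 y hy]
      · rw [norm_mul, Real.norm_eq_abs]
        refine mul_le_mul_of_nonneg_left ?_ (abs_nonneg _)
        have hmem : x + t' • y ∈ closedBall x (|t| + 1) := by
          rw [mem_closedBall, dist_self_add_left, norm_smul, Real.norm_eq_abs]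
          have h1 : |t'| ≤ |t| + 1 := by
            rw [mem_ball, Real.dist_eq] at ht'
            have := abs_sub_abs_le_abs_sub t' t
            linarith
          calc |t'| * ‖y‖ ≤ |t'| * 1 := by gcongr
            _ ≤ _ := by linarith
        calc ‖fderiv ℝ H (x + t' • y) y‖ ≤ ‖fderiv ℝ H (x + t' • y)‖ * ‖y‖ :=
              ContinuousLinearMap.le_opNorm _ _
          _ ≤ |C| * 1 := by
            gcongr
            exact (hC _ hmem).trans (le_abs_self C)
          _ = |C| := mul_one _
    · exact Continuous.integrable_of_hasCompactSupport (by fun_prop) hφc.abs.mul_right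
    · have h1 : HasDerivAt (fun t : ℝ => x + t • y) y t' := by
        simpa using ((hasDerivAt_id t').smul_const y).const_add x
      have h2 := (hH.differentiable (by simp) (x + t' • y)).hasFDerivAt
      exact (h2.comp_hasDerivAt t' h1).const_mul (φ y)
  have hzero : ∀ t ∈ Ico 0 s, ∫ y, φ y * fderiv ℝ H (x + t • y) y = 0 := by
    intro t ht
    have hdj : ∀ j : Fin n, ContDiff ℝ 1 (dd (stdVec j) H) := fun j =>
      contDiff_dd (k := 1) _ (by norm_num; exact hH)
    have hdjt : ∀ j : Fin n, ContDiff ℝ 1 (fun y : Rn n => dd (stdVec j) H (x + t • y)) := fun j =>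
      (hdj j).comp (by fun_prop)
    have hψ1 : ContDiff ℝ 1 ψ := hψ.of_le (by simp)
    have hddψ : ∀ i : Fin n, Continuous (dd (stdVec i) ψ) := fun i =>
      (contDiff_dd (k := 0) _ (by simpa using hψ1)).continuous
    have hddψc : ∀ i : Fin n, HasCompactSupport (dd (stdVec i) ψ) := fun i =>
      hψc.fderiv_apply (𝕜 := ℝ) (stdVec i)
    have e1 : ∀ y, φ y * fderiv ℝ H (x + t • y) y =
        ∑ i, ∑ j, -(a i j) * (dd (stdVec i) ψ y * dd (stdVec j) H (x + t • y)) := by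
      intro y
      have h1 : fderiv ℝ H (x + t • y) y = ∑ j, y j * dd (stdVec j) H (x + t • y) := by
        have h2 := congrArg (fderiv ℝ H (x + t • y)) (sum_smul_stdVec y)
        rw [map_sum] at h2
        rw [← h2]
        simp [dd]
      rw [h1, Finset.mul_sum, Finset.sum_comm]
      refine Finset.sum_congr rfl fun j _ => ?_
      rw [← mul_assoc, ← neg_neg (φ y * y j), ← hker, ← Finset.sum_neg_distrib, Finset.sum_mul]
      exact Finset.sum_congr rfl fun i _ => by ring
    have hInt : ∀ i j : Fin n, Integrable (fun y : Rn n =>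
        -(a i j) * (dd (stdVec i) ψ y * dd (stdVec j) H (x + t • y))) := fun i j =>
      (Continuous.integrable_of_hasCompactSupport ((hddψ i).mul (hdjt j).continuous)
        (hddψc i).mul_right).const_mul _
    simp_rw [e1]
    rw [integral_finsetSum _ fun i _ => integrable_finsetSum _ fun j _ => hInt i j]
    have e2 : ∀ i, ∫ y, ∑ j, -(a i j) * (dd (stdVec i) ψ y * dd (stdVec j) H (x + t • y)) =
        ∑ j, ∫ y, t * (ψ y * (a i j * dd (stdVec i) (dd (stdVec j) H) (x + t • y))) := by
      intro i
      rw [integral_finsetSum _ fun j _ => hInt i j]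
      refine Finset.sum_congr rfl fun j _ => ?_
      rw [integral_const_mul, integral_mul_dd_eq _ hψ1 hψc (hdjt j), neg_mul_neg,
        ← integral_const_mul]
      congr 1; funext y
      rw [dd_comp_affine _ _ _ ((hdj j).differentiable (by simp)), smul_eq_mul]
      ring
    have hint2 : ∀ i j : Fin n, Integrable (fun y : Rn n =>
        t * (ψ y * (a i j * dd (stdVec i) (dd (stdVec j) H) (x + t • y)))) := by
      intro i j
      have hc : Continuous (dd (stdVec i) (dd (stdVec j) H)) :=
        (contDiff_dd (k := 0) _ (by simpa using hdj j)).continuous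
      have := hψ.continuous
      exact (Continuous.integrable_of_hasCompactSupport (by fun_prop) hψc.mul_right).const_mul _
    simp_rw [e2]
    simp_rw [← integral_finsetSum _ fun j _ => hint2 _ j]
    rw [← integral_finsetSum _ fun i _ => integrable_finsetSum _ fun j _ => hint2 i j]
    rw [← integral_zero (Rn n) ℝ]
    congr 1; funext y
    simp only [← Finset.mul_sum]
    rcases le_or_gt 1 ‖y‖ with hy | hy
    · simp [hψ0 y hy]
    · have hmem : x + t • y ∈ ball x s := by
        rw [mem_ball, dist_self_add_left, norm_smul, Real.norm_eq_abs, abs_of_nonneg ht.1]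
        have := ht.1
        have := ht.2
        nlinarith [norm_nonneg y]
      have := hLH _ hmem
      simp only [ellOp] at this
      rw [this]; simp
  have hconst := constant_of_has_deriv_right_zero (f := fun t => ∫ y, φ y * H (x + t • y))
    (a := 0) (b := s) (fun t _ => (hderiv t).continuousAt.continuousWithinAt)
    (fun t ht => by simpa [hzero t ht] using (hderiv t).hasDerivWithinAt) s ⟨hs, le_rfl⟩
  simp only [zero_smul, add_zero] at hconst
  rw [hconst, integral_mul_const, hφ1, one_mul]

end

section

open scoped ContDiff

variable {n : ℕ}

/-- The volume of the unit ball of `ℝⁿ`. -/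
def unitBallVol (n : ℕ) : ℝ := volume.real (ball (0 : Rn n) 1)

lemma volume_real_ball (x : Rn n) {r : ℝ} (hr : 0 < r) :
    volume.real (ball x r) = r ^ n * unitBallVol n := by
  rw [measureReal_def, Measure.addHaar_ball_of_pos volume x hr, ENNReal.toReal_mul,
    ENNReal.toReal_ofReal (by positivity)]
  simp [unitBallVol, measureReal_def]

lemma unitBallVol_pos (n : ℕ) : 0 < unitBallVol n := by
  unfold unitBallVol
  exact ENNReal.toReal_pos (measure_ball_pos _ _ one_pos).ne' measure_ball_lt_top.ne

lemma sq_setIntegral_le {h : Rn n → ℝ} (hh : Continuous h) (x : Rn n) (r : ℝ) :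
    (∫ y in ball x r, h y) ^ 2 ≤ volume.real (ball x r) * ∫ y in ball x r, h y ^ 2 := by
  set V := volume.real (ball x r) with hV
  set I := ∫ y in ball x r, h y with hI
  have hi := integrableOn_ball_of_continuous hh x r
  have hi2 : IntegrableOn (fun y => h y ^ 2) (ball x r) :=
    integrableOn_ball_of_continuous (hh.pow 2) x r
  have hc : IntegrableOn (fun _ : Rn n => (1 : ℝ)) (ball x r) :=
    integrableOn_ball_of_continuous continuous_const x r
  have h0 : 0 ≤ ∫ y in ball x r, (V * h y - I) ^ 2 := integral_nonneg fun y => sq_nonneg _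
  have h1 : ∫ y in ball x r, (V * h y - I) ^ 2 =
      V * (V * ∫ y in ball x r, h y ^ 2) - V * I ^ 2 := by
    have e : ∀ y, (V * h y - I) ^ 2 = V ^ 2 * h y ^ 2 - (2 * V * I) * h y + I ^ 2 * 1 :=
      fun y => by ring
    simp_rw [e]
    rw [integral_add (f := fun y => V ^ 2 * h y ^ 2 - 2 * V * I * h y) ((hi2.const_mul _).sub (hi.const_mul _)) (hc.const_mul _),
      integral_sub (hi2.const_mul _) (hi.const_mul _), integral_const_mul, integral_const_mul,
      integral_const_mul, ← hI]
    simp only [integral_const, MeasurableSet.univ, measureReal_restrict_apply, univ_inter,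
      smul_eq_mul, mul_one, ← hV]
    ring
  rcases (measureReal_nonneg : 0 ≤ V).eq_or_lt with hv | hv
  · have : volume.restrict (ball x r) = 0 := by
      rw [Measure.restrict_eq_zero]
      exact (measureReal_eq_zero_iff measure_ball_lt_top.ne).1 hv.symm
    have : I = 0 := by rw [hI, this]; simp
    rw [this, hV, ← hv]; simp
  · rw [h1, ← mul_sub] at h0
    have := nonneg_of_mul_nonneg_right h0 hv
    linarith

lemma integral_kernel_eq (φ H : Rn n → ℝ) (x : Rn n) {s : ℝ} (hs : 0 < s) :
    s ^ n * ∫ y, φ y * H (x + s • y) = ∫ z, φ (s⁻¹ • (z - x)) * H z := by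
  have h1 := Measure.integral_comp_smul (volume : Measure (Rn n))
    (fun z => φ (s⁻¹ • z) * H (x + z)) s
  have h2 : ∫ z, φ (s⁻¹ • z) * H (x + z) = ∫ z, φ (s⁻¹ • (z - x)) * H z := by
    rw [← integral_add_left_eq_self (μ := (volume : Measure (Rn n)))
      (fun z => φ (s⁻¹ • (z - x)) * H z) x]
    simp
  have h3 : ∀ y : Rn n, s⁻¹ • s • y = y := fun y => by rw [smul_smul, inv_mul_cancel₀ hs.ne', one_smul]
  simp only [h3, h2, finrank_euclideanSpace, Fintype.card_fin, smul_eq_mul] at h1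
  rw [h1, abs_of_pos (by positivity), ← mul_assoc, mul_inv_cancel₀ (by positivity), one_mul]

/-- Interior decay estimate for solutions of the constant coefficient equation. -/
lemma exists_decay_const (a B : Matrix (Fin n) (Fin n) ℝ) (hB : ∀ i j, B i j = B j i)
    (haB : ∀ j k, ∑ i, a i j * B i k = if j = k then 1 else 0) {μ : ℝ} (hμ : 0 < μ)
    (hBμ : ∀ y : Rn n, μ * ‖y‖ ^ 2 ≤ quadForm B y) :
    ∃ C : ℝ, 0 ≤ C ∧ ∀ (H : Rn n → ℝ) (x₀ : Rn n) (r ρ : ℝ), ContDiff ℝ 2 H → 0 < r → 0 < ρ →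
      ρ ≤ 1 / 2 → (∀ y ∈ ball x₀ r, ellOp a H y = 0) →
      ∫ y in ball x₀ (ρ * r), (H y - H x₀) ^ 2 ≤ C * ρ ^ (n + 2) * ∫ y in ball x₀ r, H y ^ 2 := by
  obtain ⟨φ, ψ, hφ, hψ, hφ0, hψ0, hφ1, hker⟩ := exists_meanValue_kernel a B hB haB hμ hBμ
  have hφc : HasCompactSupport φ := HasCompactSupport.intro (isCompact_closedBall (0 : Rn n) 1)
    fun y hy => hφ0 y (by simpa using (not_le.1 (by simpa using hy) : 1 < ‖y‖).le)
  obtain ⟨L, hL⟩ := ContDiff.lipschitzWith_of_hasCompactSupport hφc hφ (by simp)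
  have hV := unitBallVol_pos n
  refine ⟨unitBallVol n ^ 2 * (L : ℝ) ^ 2 * 2 ^ (2 * n + 2), by positivity, ?_⟩
  intro H x₀ r ρ hH hr hρ hρ2 hLH
  have hHC := hH.continuous
  have hφC := hφ.continuous
  set s := r / 2 with hs
  have hs0 : 0 < s := by positivity
  set J := ∫ y in ball x₀ r, H y ^ 2 with hJ
  have hJ0 : 0 ≤ J := integral_nonneg fun y => sq_nonneg _
  have key : ∀ x ∈ ball x₀ (ρ * r), (H x - H x₀) ^ 2 ≤
      unitBallVol n * (L : ℝ) ^ 2 * 2 ^ (2 * n + 2) * (r ^ n)⁻¹ * ρ ^ 2 * J := by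
    intro x hx
    have hxd : ‖x - x₀‖ ≤ ρ * r := by rw [← dist_eq_norm]; exact (mem_ball.1 hx).le
    have hxs : ‖x - x₀‖ ≤ s := hxd.trans (by rw [hs]; nlinarith)
    have m1 := meanValue_eq a hφ hψ hφ0 hψ0 hφ1 hker hH (x := x) hs0.le fun y hy => hLH y (by
      have h2 : dist x x₀ ≤ s := by rw [dist_eq_norm]; exact hxs
      have := dist_triangle y x x₀
      have := mem_ball.1 hy
      rw [mem_ball]; linarith)
    have m2 := meanValue_eq a hφ hψ hφ0 hψ0 hφ1 hker hH (x := x₀) hs0.le fun y hy => hLH y (by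
      have := mem_ball.1 hy
      rw [mem_ball]; linarith)
    have hInt : ∀ x : Rn n, Integrable (fun z => φ (s⁻¹ • (z - x)) * H z) := by
      intro x
      refine Continuous.integrable_of_hasCompactSupport (by fun_prop) (HasCompactSupport.mul_right ?_)
      refine HasCompactSupport.intro (isCompact_closedBall x s) fun z hz => hφ0 _ ?_
      have : s < ‖z - x‖ := by rw [← dist_eq_norm]; simpa using hz
      rw [norm_smul, norm_inv, Real.norm_of_nonneg hs0.le, ← div_eq_inv_mul, le_div_iff₀ hs0]
      linarith
    have hdiff : s ^ n * (H x - H x₀) =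
        ∫ z in ball x₀ r, (φ (s⁻¹ • (z - x)) - φ (s⁻¹ • (z - x₀))) * H z := by
      rw [setIntegral_eq_integral_of_forall_compl_eq_zero]
      · rw [mul_sub, ← m1, ← m2, integral_kernel_eq _ _ _ hs0, integral_kernel_eq _ _ _ hs0,
          ← integral_sub (hInt _) (hInt _)]
        congr 1; funext z; ring
      · intro z hz
        have hz' : r ≤ ‖z - x₀‖ := by rw [← dist_eq_norm]; simpa using hz
        have hz2 : s ≤ ‖z - x‖ := by
          have := norm_add_le (z - x) (x - x₀)
          rw [sub_add_sub_cancel] at this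
          linarith
        have aux : ∀ w : Rn n, s ≤ ‖w‖ → φ (s⁻¹ • w) = 0 := fun w hw => hφ0 _ (by
          rw [norm_smul, norm_inv, Real.norm_of_nonneg hs0.le, ← div_eq_inv_mul, le_div_iff₀ hs0]
          linarith)
        rw [aux _ hz2, aux _ (by linarith)]; ring
    set I := ∫ z in ball x₀ r, |H z| with hI
    have hbd : |s ^ n * (H x - H x₀)| ≤ (L : ℝ) * (s⁻¹ * (ρ * r)) * I := by
      rw [hdiff, hI, ← integral_const_mul]
      refine (abs_integral_le_integral_abs).trans (integral_mono_of_nonneg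
        (Filter.Eventually.of_forall fun z => abs_nonneg _)
        (integrableOn_ball_of_continuous (by fun_prop) _ _)
        (Filter.Eventually.of_forall fun z => ?_))
      simp only [abs_mul]
      refine mul_le_mul_of_nonneg_right ?_ (abs_nonneg _)
      have h1 := hL.dist_le_mul (s⁻¹ • (z - x)) (s⁻¹ • (z - x₀))
      rw [Real.dist_eq, dist_eq_norm, ← smul_sub, norm_smul, norm_inv, Real.norm_of_nonneg hs0.le,
        sub_sub_sub_cancel_left, norm_sub_rev] at h1
      exact h1.trans (by gcongr)
    have hCS := sq_setIntegral_le (h := fun z => |H z|) hHC.abs x₀ r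
    simp only [sq_abs] at hCS
    rw [← hI, ← hJ, volume_real_ball _ hr] at hCS
    have h2 : s⁻¹ * (ρ * r) = 2 * ρ := by rw [hs]; field_simp
    rw [h2] at hbd
    have h3 := pow_le_pow_left₀ (abs_nonneg _) hbd 2
    rw [sq_abs] at h3
    have h4 : (s ^ n) ^ 2 * (H x - H x₀) ^ 2 ≤ ((L : ℝ) * (2 * ρ)) ^ 2 *
        (r ^ n * unitBallVol n * J) := by
      calc (s ^ n) ^ 2 * (H x - H x₀) ^ 2 = (s ^ n * (H x - H x₀)) ^ 2 := by ring
        _ ≤ _ := h3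
        _ = ((L : ℝ) * (2 * ρ)) ^ 2 * I ^ 2 := by ring
        _ ≤ _ := by gcongr
    rw [← div_le_div_iff_of_pos_right (c := (s ^ n) ^ 2) (by positivity),
      mul_div_cancel_left₀ _ (by positivity)] at h4
    refine h4.trans (le_of_eq ?_)
    rw [hs, div_pow, pow_add]
    field_simp
    ring
  calc ∫ y in ball x₀ (ρ * r), (H y - H x₀) ^ 2
      ≤ ∫ y in ball x₀ (ρ * r),
        unitBallVol n * (L : ℝ) ^ 2 * 2 ^ (2 * n + 2) * (r ^ n)⁻¹ * ρ ^ 2 * J :=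
        setIntegral_mono_on (integrableOn_ball_of_continuous (by fun_prop) _ _)
          (integrableOn_ball_of_continuous continuous_const _ _) measurableSet_ball key
    _ = (ρ * r) ^ n * unitBallVol n *
        (unitBallVol n * (L : ℝ) ^ 2 * 2 ^ (2 * n + 2) * (r ^ n)⁻¹ * ρ ^ 2 * J) := by
        rw [setIntegral_const, volume_real_ball _ (by positivity), smul_eq_mul]
    _ = _ := by
        rw [mul_pow]
        field_simp
        ring

end

section

open scoped ContDiff

variable {n : ℕ}

lemma contDiff_dd_smooth {f : Rn n → ℝ} (hf : ContDiff ℝ ∞ f) (v : Rn n) :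
    ContDiff ℝ ∞ (dd v f) :=
  contDiff_dd (k := ⊤) v (hf.of_le (by simp))

lemma dd_add {f g : Rn n → ℝ} (hf : Differentiable ℝ f) (hg : Differentiable ℝ g) (v : Rn n) :
    dd v (fun x => f x + g x) = fun x => dd v f x + dd v g x := by
  funext x
  have := ((hf x).hasFDerivAt.add (hg x).hasFDerivAt).fderiv
  simp only [dd]
  erw [this]
  simp

lemma dd_const_mul {f : Rn n → ℝ} (hf : Differentiable ℝ f) (c : ℝ) (v : Rn n) :
    dd v (fun x => c * f x) = fun x => c * dd v f x := by
  funext x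
  have := ((hf x).hasFDerivAt.const_mul c).fderiv
  simp [dd, this]

lemma dd_sub_const (f : Rn n → ℝ) (c : ℝ) (v : Rn n) :
    dd v (fun x => f x - c) = dd v f := by
  funext x
  simp only [dd]
  rw [fderiv_sub_const]

lemma dd_sum {ι : Type*} (s : Finset ι) {f : ι → Rn n → ℝ} (hf : ∀ i, Differentiable ℝ (f i))
    (v : Rn n) :
    dd v (fun x => ∑ i ∈ s, f i x) = fun x => ∑ i ∈ s, dd v (f i) x := by
  funext x
  have := (HasFDerivAt.fun_sum (u := s) fun i _ => (hf i x).hasFDerivAt).fderiv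
  simp [dd, this]

lemma dd_dd_eq {f : Rn n → ℝ} (hf : ContDiff ℝ 2 f) (v w x : Rn n) :
    dd v (dd w f) x = D2 f x v w := by
  have h : Differentiable ℝ (fderiv ℝ f) :=
    (hf.fderiv_right (m := 1) (by norm_num)).differentiable (by simp)
  have := ((h x).hasFDerivAt.clm_apply (hasFDerivAt_const w x)).fderiv
  have e : dd w f = fun y => fderiv ℝ f y w := rfl
  rw [dd, e, D2, this]
  simp

lemma dd_comm {f : Rn n → ℝ} (hf : ContDiff ℝ 2 f) (v w : Rn n) :
    dd v (dd w f) = dd w (dd v f) := by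
  funext x
  rw [dd_dd_eq hf, dd_dd_eq hf]
  exact (hf.contDiffAt.isSymmSndFDerivAt (by simp)) v w

lemma contDiff_ellOp {w : Rn n → ℝ} (hw : ContDiff ℝ ∞ w) (a : Matrix (Fin n) (Fin n) ℝ) :
    ContDiff ℝ ∞ (ellOp a w) :=
  ContDiff.sum fun _ _ => ContDiff.sum fun _ _ =>
    contDiff_const.mul (contDiff_dd_smooth (contDiff_dd_smooth hw _) _)

lemma dd_ellOp {w : Rn n → ℝ} (hw : ContDiff ℝ ∞ w) (a : Matrix (Fin n) (Fin n) ℝ) (v : Rn n) :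
    dd v (ellOp a w) = ellOp a (dd v w) := by
  have hd : ∀ i j : Fin n, Differentiable ℝ (dd (stdVec i) (dd (stdVec j) w)) := fun i j =>
    (contDiff_dd_smooth (contDiff_dd_smooth hw _) _).differentiable (by simp)
  have h2 : ∀ {g : Rn n → ℝ}, ContDiff ℝ ∞ g → ContDiff ℝ 2 g := fun h => contDiff_infty.1 h 2
  unfold ellOp
  rw [dd_sum _ (fun i => by
    exact Differentiable.fun_sum fun j _ => (hd i j).const_mul _)]
  funext x
  refine Finset.sum_congr rfl fun i _ => ?_
  rw [dd_sum _ (fun j => (hd i j).const_mul _)]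
  refine Finset.sum_congr rfl fun j _ => ?_
  rw [dd_const_mul (hd i j), dd_comm (h2 (contDiff_dd_smooth hw _)), dd_comm (h2 hw)]

lemma ellOp_sub {f g : Rn n → ℝ} (hf : ContDiff ℝ ∞ f) (hg : ContDiff ℝ ∞ g) (c : ℝ)
    (a : Matrix (Fin n) (Fin n) ℝ) (x : Rn n) :
    ellOp a (fun x => f x - g x - c) x = ellOp a f x - ellOp a g x := by
  have e : (fun x => f x - g x - c) = fun x => (f x + (-1) * g x) - c := by funext x; ring
  have hd : ∀ {g : Rn n → ℝ}, ContDiff ℝ ∞ g → Differentiable ℝ g :=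
    fun h => h.differentiable (by simp)
  unfold ellOp
  rw [← Finset.sum_sub_distrib]
  refine Finset.sum_congr rfl fun i _ => ?_
  rw [← Finset.sum_sub_distrib]
  refine Finset.sum_congr rfl fun j _ => ?_
  rw [e, dd_sub_const, dd_add (hd hf) ((hd hg).const_mul _), dd_const_mul (hd hg),
    dd_add (hd (contDiff_dd_smooth hf _)) ((hd (contDiff_dd_smooth hg _)).const_mul _),
    dd_const_mul (hd (contDiff_dd_smooth hg _))]
  ring

lemma dd_congr_of_eqOn {F : Type*} [NormedAddCommGroup F] [NormedSpace ℝ F] {f g : Rn n → F}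
    {s : Set (Rn n)} (hs : IsOpen s) (h : EqOn f g s) (v : Rn n) : EqOn (dd v f) (dd v g) s := by
  intro x hx
  simp only [dd]
  rw [(h.eventuallyEq_of_mem (hs.mem_nhds hx)).fderiv_eq]

/-- Ellipticity data: `a` is a positive definite matrix and `B` its inverse. -/
structure EllData (a B : Matrix (Fin n) (Fin n) ℝ) (lam μ : ℝ) : Prop where
  symm : ∀ i j, B i j = B j i
  inv : ∀ j k, ∑ i, a i j * B i k = if j = k then 1 else 0
  lam_pos : 0 < lam
  coercive : ∀ ξ : Rn n, lam * ‖ξ‖ ^ 2 ≤ quadForm a ξ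
  mu_pos : 0 < μ
  coercive' : ∀ y : Rn n, μ * ‖y‖ ^ 2 ≤ quadForm B y

lemma setIntegral_sq_add_le {f g h : Rn n → ℝ} (hf : Continuous f) (hg : Continuous g)
    (hh : Continuous h) (hfg : ∀ x, f x = g x + h x) (x : Rn n) (r : ℝ) :
    ∫ y in ball x r, f y ^ 2 ≤ 2 * (∫ y in ball x r, g y ^ 2) + 2 * ∫ y in ball x r, h y ^ 2 := by
  rw [← integral_const_mul, ← integral_const_mul, ← integral_add
    (integrableOn_ball_of_continuous (by fun_prop) _ _)
    (integrableOn_ball_of_continuous (by fun_prop) _ _)]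
  refine setIntegral_mono (integrableOn_ball_of_continuous (by fun_prop) _ _)
    (integrableOn_ball_of_continuous (by fun_prop) _ _) fun y => ?_
  simp only [hfg]
  nlinarith [sq_nonneg (g y - h y)]

lemma setIntegral_ball_mono {f : Rn n → ℝ} (hf : Continuous f) (hf0 : ∀ x, 0 ≤ f x) {x x' : Rn n}
    {r R : ℝ} (h : ball x r ⊆ ball x' R) : ∫ y in ball x r, f y ≤ ∫ y in ball x' R, f y :=
  setIntegral_mono_set (integrableOn_ball_of_continuous hf _ _)
    (Filter.Eventually.of_forall fun y => hf0 y) h.eventuallyLE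

lemma exists_linear_decay_smooth {a B : Matrix (Fin n) (Fin n) ℝ} {lam μ : ℝ}
    (hE : EllData a B lam μ) :
    ∃ C : ℝ, 0 ≤ C ∧ ∀ (w : Rn n → ℝ) (x₀ : Rn n) (r ρ A c : ℝ) (v v' : Rn n),
      ContDiff ℝ ∞ w → 0 < r → 0 < ρ → ρ ≤ 1 / 4 → ‖v‖ ≤ 1 → ‖v'‖ ≤ 1 →
      ∃ A' : ℝ, ∫ y in ball x₀ (ρ * r), (dd v (dd v' w) y - A') ^ 2 ≤
        C * ρ ^ (n + 2) * (∫ y in ball x₀ r, (dd v (dd v' w) y - A) ^ 2) +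
        C * ∫ y in ball x₀ r, (ellOp a w y - c) ^ 2 := by
  obtain ⟨C₀, hC₀, hdec⟩ := exists_decay_const a B hE.symm hE.inv hE.mu_pos hE.coercive'
  set D := 2 * (C₀ * 2 ^ (n + 2)) with hD
  have hD0 : 0 ≤ D := by positivity
  have hL0 : 0 ≤ (1 / lam) ^ 2 := by positivity
  refine ⟨2 * D + (2 * D + 2) * (1 / lam) ^ 2, by positivity, ?_⟩
  intro w x₀ r ρ A c v v' hw hr hρ hρ4 hv hv'
  let χ : ContDiffBump x₀ := ⟨r / 2, r, by positivity, by linarith⟩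
  set g := dd v (dd v' w) with hg
  have hgs : ContDiff ℝ ∞ g := contDiff_dd_smooth (contDiff_dd_smooth hw _) _
  have hLs := contDiff_ellOp hw a
  have hGs : ContDiff ℝ ∞ (fun x => (ellOp a w x - c) * χ x) :=
    (hLs.sub contDiff_const).mul χ.contDiff
  obtain ⟨p, hps, hpe, hpb⟩ := exists_potential a hE.lam_pos hE.coercive v v' hv hv' hGs
    χ.hasCompactSupport.mul_left
  have hgC := hgs.continuous
  have hpC := hps.continuous
  have hLC := hLs.continuous
  set P := ∫ y in ball x₀ r, (ellOp a w y - c) ^ 2 with hP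
  set Q := ∫ y in ball x₀ r, (g y - A) ^ 2 with hQ
  have hP0 : 0 ≤ P := integral_nonneg fun y => sq_nonneg _
  have hQ0 : 0 ≤ Q := integral_nonneg fun y => sq_nonneg _
  have hGP : ∫ x, ((ellOp a w x - c) * χ x) ^ 2 ≤ P := by
    rw [← setIntegral_eq_integral_of_forall_compl_eq_zero (s := ball x₀ r)]
    · refine setIntegral_mono
        (integrableOn_ball_of_continuous (by have := χ.continuous; fun_prop) _ _)
        (integrableOn_ball_of_continuous (by fun_prop) _ _) fun y => ?_
      have h1 := χ.nonneg (x := y)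
      have h2 := χ.le_one (x := y)
      have h3 : χ y ^ 2 ≤ 1 := pow_le_one₀ h1 h2
      simp only [mul_pow]
      nlinarith [sq_nonneg (ellOp a w y - c)]
    · intro y hy
      rw [χ.zero_of_le_dist (by simpa using hy)]
      ring
  have hpP : ∀ z R, ∫ x in ball z R, p x ^ 2 ≤ (1 / lam) ^ 2 * P := fun z R =>
    (hpb z R).trans (mul_le_mul_of_nonneg_left hGP hL0)
  set H : Rn n → ℝ := fun x => g x - p x - A with hH
  have hHs : ContDiff ℝ ∞ H := (hgs.sub hps).sub contDiff_const
  have hHC := hHs.continuous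
  have hLH : ∀ y ∈ ball x₀ (r / 2), ellOp a H y = 0 := by
    intro y hy
    rw [hH, ellOp_sub hgs hps, hpe, hg, ← dd_ellOp (contDiff_dd_smooth hw _), ← dd_ellOp hw,
      sub_eq_zero]
    refine dd_congr_of_eqOn isOpen_ball (fun z hz => ?_) v hy
    rw [← dd_sub_const _ c]
    refine dd_congr_of_eqOn isOpen_ball (fun z hz => ?_) v' hz
    rw [χ.one_of_mem_closedBall (ball_subset_closedBall hz), mul_one]
  have h1 := hdec H x₀ (r / 2) (2 * ρ) (contDiff_infty.1 hHs 2) (by positivity) (by positivity)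
    (by linarith) hLH
  rw [show 2 * ρ * (r / 2) = ρ * r by ring, mul_pow] at h1
  have hsub : ball x₀ (r / 2) ⊆ ball x₀ r := ball_subset_ball (by linarith)
  have h2 : ∫ y in ball x₀ (r / 2), H y ^ 2 ≤ 2 * Q + 2 * ((1 / lam) ^ 2 * P) := by
    have := setIntegral_sq_add_le (f := H) (g := fun x => g x - A) (h := fun x => - p x) hHC
      (by fun_prop) (by fun_prop) (fun x => by simp only [hH]; ring) x₀ (r / 2)
    simp only [neg_sq] at this
    have h3 : ∫ y in ball x₀ (r / 2), (g y - A) ^ 2 ≤ Q :=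
      setIntegral_ball_mono (f := fun y => (g y - A) ^ 2) (by fun_prop) (fun y => sq_nonneg _) hsub
    have h4 := hpP x₀ (r / 2)
    linarith
  refine ⟨A + H x₀, ?_⟩
  have h5 := setIntegral_sq_add_le (f := fun y => g y - (A + H x₀)) (g := fun y => H y - H x₀)
    (h := p) (by fun_prop) (by fun_prop) hpC (fun x => by simp only [hH]; ring) x₀ (ρ * r)
  refine h5.trans ?_
  have h6 := hpP x₀ (ρ * r)
  have hρ1 : ρ ^ (n + 2) ≤ 1 := pow_le_one₀ hρ.le (by linarith)
  have hρ0 : 0 ≤ ρ ^ (n + 2) := by positivity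
  set t := ρ ^ (n + 2) with ht
  set L := (1 / lam) ^ 2 with hL
  have h7 : 2 * ∫ y in ball x₀ (ρ * r), (H y - H x₀) ^ 2 ≤ D * t * (2 * Q + 2 * (L * P)) := by
    calc 2 * ∫ y in ball x₀ (ρ * r), (H y - H x₀) ^ 2
        ≤ 2 * (C₀ * (2 ^ (n + 2) * t) * ∫ y in ball x₀ (r / 2), H y ^ 2) := by gcongr
      _ ≤ 2 * (C₀ * (2 ^ (n + 2) * t) * (2 * Q + 2 * (L * P))) := by gcongr
      _ = _ := by rw [hD]; ring
  have h8 : D * t * (L * P) ≤ D * 1 * (L * P) := by gcongr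
  have h9 : 0 ≤ ((2 * D + 2) * L) * t * Q := by positivity
  have h10 : 0 ≤ 2 * D * P := by positivity
  linarith

end

section

open scoped ContDiff Convolution

variable {n : ℕ}

lemma abs_D2_le (T : Rn n →L[ℝ] Rn n →L[ℝ] ℝ) {v v' : Rn n} (hv : ‖v‖ ≤ 1) (hv' : ‖v'‖ ≤ 1) :
    |T v v'| ≤ ‖T‖ := by
  have h := T.le_opNorm₂ v v'
  rw [Real.norm_eq_abs] at h
  refine h.trans ?_
  calc ‖T‖ * ‖v‖ * ‖v'‖ ≤ ‖T‖ * 1 * 1 := by gcongr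
    _ = ‖T‖ := by ring

lemma dd_convolution {f g : Rn n → ℝ} (hf : LocallyIntegrable f) (hg : ContDiff ℝ 1 g)
    (hgc : HasCompactSupport g) (v : Rn n) :
    dd v (f ⋆[ContinuousLinearMap.lsmul ℝ ℝ, volume] g) =
      f ⋆[ContinuousLinearMap.lsmul ℝ ℝ, volume] (dd v g) := by
  funext x
  have h := (hgc.hasFDerivAt_convolution_right (ContinuousLinearMap.lsmul ℝ ℝ) hf hg x).fderiv
  rw [dd, h, convolution_precompR_apply _ hf (hgc.fderiv (𝕜 := ℝ))
    (hg.continuous_fderiv (by simp))]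
  rfl

/-- Compactly supported `C²` functions are limits of smooth functions in the `C²` seminorm. -/
lemma exists_smooth_approx {w : Rn n → ℝ} (hw : ContDiff ℝ 2 w) (hwc : HasCompactSupport w)
    {η : ℝ} (hη : 0 < η) :
    ∃ w' : Rn n → ℝ, ContDiff ℝ ∞ w' ∧ ∀ v v' : Rn n, ‖v‖ ≤ 1 → ‖v'‖ ≤ 1 → ∀ x,
      |dd v (dd v' w') x - dd v (dd v' w) x| ≤ η := by
  have h1 : ContDiff ℝ 1 (fderiv ℝ w) := hw.fderiv_right (m := 1) (by norm_num)
  have hTc : HasCompactSupport (fderiv ℝ (fderiv ℝ w)) := (hwc.fderiv (𝕜 := ℝ)).fderiv (𝕜 := ℝ)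
  have hT : UniformContinuous (fderiv ℝ (fderiv ℝ w)) :=
    hTc.uniformContinuous_of_continuous (h1.continuous_fderiv (by simp))
  obtain ⟨δ, hδ, hT⟩ := (Metric.uniformContinuous_iff (α := Rn n)
    (β := Rn n →L[ℝ] Rn n →L[ℝ] ℝ)).1 hT η hη
  let χ : ContDiffBump (0 : Rn n) := ⟨δ / 2, δ, by positivity, by linarith⟩
  have hχs : ContDiff ℝ ∞ (χ.normed volume) := χ.contDiff_normed
  have hχl : LocallyIntegrable (χ.normed volume) volume := hχs.continuous.locallyIntegrable
  refine ⟨χ.normed volume ⋆[ContinuousLinearMap.lsmul ℝ ℝ, volume] w,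
    χ.hasCompactSupport_normed.contDiff_convolution_left _ hχs hw.continuous.locallyIntegrable,
    fun v v' hv hv' x => ?_⟩
  have hw1 : ContDiff ℝ 1 w := hw.of_le (by norm_num)
  have hdw : ContDiff ℝ 1 (dd v' w) := contDiff_dd (k := 1) v' (by norm_num; exact hw)
  rw [dd_convolution hχl hw1 hwc, dd_convolution hχl hdw (hwc.fderiv_apply (𝕜 := ℝ) v'),
    ← Real.dist_eq]
  have hc : Continuous (dd v (dd v' w)) :=
    (contDiff_dd (k := 0) v (by simpa using hdw)).continuous
  refine χ.dist_normed_convolution_le hc.aestronglyMeasurable fun y hy => ?_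
  rw [Real.dist_eq, dd_dd_eq hw, dd_dd_eq hw]
  have h2 : ‖fderiv ℝ (fderiv ℝ w) y - fderiv ℝ (fderiv ℝ w) x‖ ≤ η :=
    (dist_eq_norm (fderiv ℝ (fderiv ℝ w) y) (fderiv ℝ (fderiv ℝ w) x)).ge.trans
      (hT (mem_ball.1 hy)).le
  exact (abs_D2_le (fderiv ℝ (fderiv ℝ w) y - fderiv ℝ (fderiv ℝ w) x) hv hv').trans h2

lemma setIntegral_sq_sub_mean_le {g : Rn n → ℝ} (hg : Continuous g) (x : Rn n) {r : ℝ} (hr : 0 < r)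
    (A : ℝ) :
    ∫ y in ball x r, (g y - (volume.real (ball x r))⁻¹ * ∫ z in ball x r, g z) ^ 2 ≤
      ∫ y in ball x r, (g y - A) ^ 2 := by
  set V := volume.real (ball x r) with hV
  have hV0 : 0 < V := by
    rw [hV, volume_real_ball x hr]
    have := unitBallVol_pos n
    positivity
  set I := ∫ z in ball x r, g z with hI
  set m := V⁻¹ * I with hm
  have e : ∀ y, (g y - A) ^ 2 = (g y - m) ^ 2 + (2 * (m - A) * g y + (m - A) * (-m - A)) := fun y => by
    ring
  simp_rw [e]
  rw [integral_add (integrableOn_ball_of_continuous (by fun_prop) _ _)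
    (integrableOn_ball_of_continuous (by fun_prop) _ _),
    integral_add (integrableOn_ball_of_continuous (by fun_prop) _ _)
    (integrableOn_ball_of_continuous (by fun_prop) _ _), integral_const_mul, setIntegral_const,
    ← hI, ← hV, smul_eq_mul]
  have h1 : I = V * m := by rw [hm, mul_inv_cancel_left₀ hV0.ne']
  rw [h1]
  nlinarith [mul_nonneg hV0.le (sq_nonneg (m - A))]

lemma setIntegral_le_of_sq_le {h : Rn n → ℝ} (hh : Continuous h) {η : ℝ} (hη : ∀ x, |h x| ≤ η)
    (x : Rn n) {r : ℝ} :
    ∫ y in ball x r, h y ^ 2 ≤ η ^ 2 * volume.real (ball x r) := by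
  have : ∫ y in ball x r, h y ^ 2 ≤ ∫ y in ball x r, η ^ 2 :=
    setIntegral_mono (integrableOn_ball_of_continuous (by fun_prop) _ _)
      (integrableOn_ball_of_continuous (by fun_prop) _ _) fun y => by
        rw [← sq_abs (h y)]
        exact pow_le_pow_left₀ (abs_nonneg _) (hη y) 2
  rwa [setIntegral_const, smul_eq_mul, mul_comm] at this

lemma norm_stdVec_le (i : Fin n) : ‖stdVec i‖ ≤ 1 := by simp [stdVec]

lemma continuous_dd_dd {w : Rn n → ℝ} (hw : ContDiff ℝ 2 w) (v v' : Rn n) :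
    Continuous (dd v (dd v' w)) :=
  (contDiff_dd (k := 0) v (by
    simpa using contDiff_dd (k := 1) v' (by norm_num; exact hw))).continuous

lemma continuous_ellOp {w : Rn n → ℝ} (hw : ContDiff ℝ 2 w) (a : Matrix (Fin n) (Fin n) ℝ) :
    Continuous (ellOp a w) :=
  continuous_finsetSum _ fun _ _ => continuous_finsetSum _ fun _ _ =>
    continuous_const.mul (continuous_dd_dd hw _ _)

lemma exists_linear_decay {a B : Matrix (Fin n) (Fin n) ℝ} {lam μ : ℝ}
    (hE : EllData a B lam μ) :
    ∃ C : ℝ, 0 ≤ C ∧ ∀ (w : Rn n → ℝ) (x₀ : Rn n) (r ρ A c : ℝ) (v v' : Rn n),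
      ContDiff ℝ 2 w → HasCompactSupport w → 0 < r → 0 < ρ → ρ ≤ 1 / 4 → ‖v‖ ≤ 1 → ‖v'‖ ≤ 1 →
      ∃ A' : ℝ, ∫ y in ball x₀ (ρ * r), (dd v (dd v' w) y - A') ^ 2 ≤
        C * ρ ^ (n + 2) * (∫ y in ball x₀ r, (dd v (dd v' w) y - A) ^ 2) +
        C * ∫ y in ball x₀ r, (ellOp a w y - c) ^ 2 := by
  obtain ⟨C, hC, hlin⟩ := exists_linear_decay_smooth hE
  refine ⟨4 * C, by positivity, ?_⟩
  intro w x₀ r ρ A c v v' hw hwc hr hρ hρ4 hv hv'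
  set g := dd v (dd v' w) with hg
  have hgC : Continuous g := continuous_dd_dd hw v v'
  have hLC := continuous_ellOp hw a
  refine ⟨(volume.real (ball x₀ (ρ * r)))⁻¹ * ∫ z in ball x₀ (ρ * r), g z, ?_⟩
  set S := ∑ i, ∑ j, |a i j| with hS
  have hS0 : 0 ≤ S := Finset.sum_nonneg fun i _ => Finset.sum_nonneg fun j _ => abs_nonneg _
  set V := volume.real (ball x₀ r)
  set V' := volume.real (ball x₀ (ρ * r))
  set P := ∫ y in ball x₀ r, (ellOp a w y - c) ^ 2 with hP
  set Q := ∫ y in ball x₀ r, (g y - A) ^ 2 with hQ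
  set K := 2 * (C * ρ ^ (n + 2) * (2 * V) + C * (2 * (S ^ 2 * V))) + 2 * V' with hK
  have key : ∀ η > 0,
      ∫ y in ball x₀ (ρ * r), (g y - (volume.real (ball x₀ (ρ * r)))⁻¹ *
        ∫ z in ball x₀ (ρ * r), g z) ^ 2 ≤
      4 * C * ρ ^ (n + 2) * Q + 4 * C * P + K * η ^ 2 := by
    intro η hη
    obtain ⟨w', hw', happ⟩ := exists_smooth_approx hw hwc hη
    have hw'2 : ContDiff ℝ 2 w' := contDiff_infty.1 hw' 2
    have hg'C : Continuous (dd v (dd v' w')) := continuous_dd_dd hw'2 v v'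
    have hL'C := continuous_ellOp hw'2 a
    obtain ⟨A', hA'⟩ := hlin w' x₀ r ρ A c v v' hw' hr hρ hρ4 hv hv'
    have hLapp : ∀ x, |ellOp a w' x - ellOp a w x| ≤ S * η := by
      intro x
      rw [ellOp, ellOp, ← Finset.sum_sub_distrib, hS, Finset.sum_mul]
      refine (Finset.abs_sum_le_sum_abs _ _).trans (Finset.sum_le_sum fun i _ => ?_)
      rw [← Finset.sum_sub_distrib, Finset.sum_mul]
      refine (Finset.abs_sum_le_sum_abs _ _).trans (Finset.sum_le_sum fun j _ => ?_)
      rw [← mul_sub, abs_mul]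
      exact mul_le_mul_of_nonneg_left (happ _ _ (norm_stdVec_le i) (norm_stdVec_le j) x)
        (abs_nonneg _)
    have e1 := setIntegral_sq_add_le (f := fun y => dd v (dd v' w') y - A) (g := fun y => g y - A)
      (h := fun y => dd v (dd v' w') y - g y) (by fun_prop) (by fun_prop) (by fun_prop)
      (fun x => by ring) x₀ r
    have e1' := setIntegral_le_of_sq_le (h := fun y => dd v (dd v' w') y - g y) (by fun_prop)
      (happ v v' hv hv') x₀ (r := r)
    have e2 := setIntegral_sq_add_le (f := fun y => ellOp a w' y - c) (g := fun y => ellOp a w y - c)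
      (h := fun y => ellOp a w' y - ellOp a w y) (by fun_prop) (by fun_prop) (by fun_prop)
      (fun x => by ring) x₀ r
    have e2' := setIntegral_le_of_sq_le (h := fun y => ellOp a w' y - ellOp a w y) (by fun_prop)
      hLapp x₀ (r := r)
    have e3 := setIntegral_sq_add_le (f := fun y => g y - A') (g := fun y => dd v (dd v' w') y - A')
      (h := fun y => g y - dd v (dd v' w') y) (by fun_prop) (by fun_prop) (by fun_prop)
      (fun x => by ring) x₀ (ρ * r)
    have e3' := setIntegral_le_of_sq_le (h := fun y => g y - dd v (dd v' w') y) (by fun_prop)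
      (fun x => by rw [abs_sub_comm]; exact happ v v' hv hv' x) x₀ (r := ρ * r)
    have e4 := setIntegral_sq_sub_mean_le hgC x₀ (r := ρ * r) (by positivity) A'
    have f1 : C * ρ ^ (n + 2) * ∫ y in ball x₀ r, (dd v (dd v' w') y - A) ^ 2 ≤
        C * ρ ^ (n + 2) * (2 * Q + 2 * (η ^ 2 * V)) := by
      gcongr
      linarith
    have f2 : C * ∫ y in ball x₀ r, (ellOp a w' y - c) ^ 2 ≤
        C * (2 * P + 2 * ((S * η) ^ 2 * V)) := by
      gcongr
      linarith
    rw [hK]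
    linarith
  have hlim : Filter.Tendsto (fun η : ℝ => 4 * C * ρ ^ (n + 2) * Q + 4 * C * P + K * η ^ 2)
      (nhdsWithin 0 (Ioi 0)) (nhds (4 * C * ρ ^ (n + 2) * Q + 4 * C * P + K * 0 ^ 2)) :=
    (Continuous.tendsto (by fun_prop) 0).mono_left nhdsWithin_le_nhds
  have := ge_of_tendsto hlim (Filter.eventually_of_mem self_mem_nhdsWithin key)
  simpa using this

end

section

variable {n : ℕ} {E : Type*} [NormedAddCommGroup E]

/-- The (unnormalised) quadratic oscillation of `Ψ` around the value `A` on a ball. -/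
def osc (Ψ : Rn n → E) (A : E) (x : Rn n) (r : ℝ) : ℝ := ∫ y in ball x r, ‖Ψ y - A‖ ^ 2

/-- The scale `r ^ (n + 2α)` of Campanato's characterisation of Hölder continuity. -/
def campanatoScale (n : ℕ) (α r : ℝ) : ℝ := r ^ n * (r ^ α) ^ 2

lemma campanatoScale_mul {α r s : ℝ} (hr : 0 ≤ r) (hs : 0 ≤ s) :
    campanatoScale n α (r * s) = campanatoScale n α r * campanatoScale n α s := by
  simp only [campanatoScale, Real.mul_rpow hr hs, mul_pow]
  ring

lemma campanatoScale_pos {α r : ℝ} (hr : 0 < r) : 0 < campanatoScale n α r := by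
  unfold campanatoScale
  have := Real.rpow_pos_of_pos hr α
  positivity

lemma osc_nonneg (Ψ : Rn n → E) (A : E) (x : Rn n) (r : ℝ) : 0 ≤ osc Ψ A x r :=
  integral_nonneg fun _ => by positivity

lemma osc_mono {Ψ : Rn n → E} (hΨ : Continuous Ψ) (A : E) {x x' : Rn n} {r R : ℝ}
    (h : ball x r ⊆ ball x' R) : osc Ψ A x r ≤ osc Ψ A x' R :=
  setIntegral_ball_mono (f := fun y => ‖Ψ y - A‖ ^ 2) (by fun_prop) (fun y => by positivity) h

lemma osc_le_of_osc {Ψ : Rn n → E} (hΨ : Continuous Ψ) (A A' : E) (x : Rn n) (r : ℝ) :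
    osc Ψ A x r ≤ 2 * osc Ψ A' x r + 2 * (‖A' - A‖ ^ 2 * volume.real (ball x r)) := by
  have e : ‖A' - A‖ ^ 2 * volume.real (ball x r) = ∫ y in ball x r, ‖A' - A‖ ^ 2 := by
    rw [setIntegral_const, smul_eq_mul, mul_comm]
  rw [e, osc, osc, ← integral_const_mul, ← integral_const_mul, ← integral_add
    (integrableOn_ball_of_continuous (by fun_prop) _ _)
    (integrableOn_ball_of_continuous (by fun_prop) _ _)]
  refine setIntegral_mono (integrableOn_ball_of_continuous (by fun_prop) _ _)
    (integrableOn_ball_of_continuous (by fun_prop) _ _) fun y => ?_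
  have h1 := norm_add_le (Ψ y - A') (A' - A)
  rw [sub_add_sub_cancel] at h1
  have h2 := pow_le_pow_left₀ (norm_nonneg _) h1 2
  simp only
  nlinarith [sq_nonneg (‖Ψ y - A'‖ - ‖A' - A‖)]

lemma norm_sub_sq_mul_le {Ψ : Rn n → E} (hΨ : Continuous Ψ) (A A' : E) (x : Rn n) (r : ℝ) :
    ‖A' - A‖ ^ 2 * volume.real (ball x r) ≤ 2 * osc Ψ A x r + 2 * osc Ψ A' x r := by
  have e : ‖A' - A‖ ^ 2 * volume.real (ball x r) = ∫ y in ball x r, ‖A' - A‖ ^ 2 := by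
    rw [setIntegral_const, smul_eq_mul, mul_comm]
  rw [e, osc, osc, ← integral_const_mul, ← integral_const_mul, ← integral_add
    (integrableOn_ball_of_continuous (by fun_prop) _ _)
    (integrableOn_ball_of_continuous (by fun_prop) _ _)]
  refine setIntegral_mono (integrableOn_ball_of_continuous (by fun_prop) _ _)
    (integrableOn_ball_of_continuous (by fun_prop) _ _) fun y => ?_
  have h1 := norm_sub_le (Ψ y - A) (Ψ y - A')
  rw [sub_sub_sub_cancel_left] at h1
  have h2 := pow_le_pow_left₀ (norm_nonneg _) h1 2
  simp only
  nlinarith [sq_nonneg (‖Ψ y - A‖ - ‖Ψ y - A'‖)]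

lemma exists_osc_value_le {Ψ : Rn n → E} (hΨ : Continuous Ψ) (A : E) (x : Rn n) {r : ℝ}
    (hr : 0 < r) : ∃ y ∈ ball x r, osc Ψ (Ψ y) x r ≤ 4 * osc Ψ A x r := by
  have hV : 0 < volume.real (ball x r) := by
    rw [volume_real_ball x hr]
    have := unitBallVol_pos n
    positivity
  obtain ⟨y, hy, hle⟩ := exists_le_setAverage (μ := volume) (s := ball x r)
    (f := fun y => ‖Ψ y - A‖ ^ 2) (measure_ball_pos _ _ hr).ne' measure_ball_lt_top.ne
    (integrableOn_ball_of_continuous (by fun_prop) _ _)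
  refine ⟨y, hy, (osc_le_of_osc hΨ (Ψ y) A x r).trans ?_⟩
  rw [setAverage_eq, smul_eq_mul, ← div_eq_inv_mul, le_div_iff₀ hV, norm_sub_rev] at hle
  change _ ≤ osc Ψ A x r at hle
  linarith

/-- Iteration of a one-step decay estimate for the oscillation. -/
lemma exists_osc_le_scale {Ψ : Rn n → E} (hΨ : Continuous Ψ) {α ρ R θ M K : ℝ} {x : Rn n}
    (hρ : 0 < ρ) (hρ1 : ρ < 1) (hR : 0 < R) (hθ0 : 0 ≤ θ) (hK : 0 ≤ K)
    (hθ : 8 * θ ≤ campanatoScale n α ρ) (hM : 8 * M ≤ K * campanatoScale n α ρ)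
    (hstep : ∀ r, 0 < r → r ≤ R → ∀ y ∈ ball x r, ∃ A' : E,
      osc Ψ A' x (ρ * r) ≤ θ * osc Ψ (Ψ y) x r + M * campanatoScale n α r)
    (hinit : ∃ y ∈ ball x R, osc Ψ (Ψ y) x R ≤ K * campanatoScale n α R) (k : ℕ) :
    ∃ y ∈ ball x (ρ ^ k * R),
      osc Ψ (Ψ y) x (ρ ^ k * R) ≤ K * campanatoScale n α (ρ ^ k * R) := by
  induction k with
  | zero => simpa using hinit
  | succ k ih =>
    obtain ⟨y, hy, hle⟩ := ih
    have hr : 0 < ρ ^ k * R := by positivity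
    have hrR : ρ ^ k * R ≤ R := mul_le_of_le_one_left hR.le (pow_le_one₀ hρ.le hρ1.le)
    obtain ⟨A', hA'⟩ := hstep _ hr hrR y hy
    obtain ⟨y', hy', hle'⟩ := exists_osc_value_le hΨ A' x (r := ρ * (ρ ^ k * R)) (by positivity)
    have e : ρ ^ (k + 1) * R = ρ * (ρ ^ k * R) := by ring
    rw [e]
    refine ⟨y', hy', hle'.trans ?_⟩
    rw [campanatoScale_mul hρ.le hr.le]
    have hs := campanatoScale_pos (n := n) (α := α) hr
    set S := campanatoScale n α (ρ ^ k * R)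
    set T := campanatoScale n α ρ
    have h1 : θ * osc Ψ (Ψ y) x (ρ ^ k * R) ≤ θ * (K * S) := by gcongr
    have h2 : 8 * θ * (K * S) ≤ T * (K * S) := by gcongr
    have h3 : 8 * M * S ≤ K * T * S := by gcongr
    linarith

lemma exists_campanato_bound (n : ℕ) {α ρ K : ℝ} (hα : 0 < α) (hρ : 0 < ρ) (hρ1 : ρ < 1)
    (hK : 0 ≤ K) :
    ∃ K' : ℝ, 0 ≤ K' ∧ ∀ (Ψ : Rn n → E) (x : Rn n) (R : ℝ), Continuous Ψ → 0 < R →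
      (∀ k : ℕ, ∃ y ∈ ball x (ρ ^ k * R),
        osc Ψ (Ψ y) x (ρ ^ k * R) ≤ K * campanatoScale n α (ρ ^ k * R)) →
      ∀ k : ℕ, osc Ψ (Ψ x) x (ρ ^ k * R) ≤ K' * campanatoScale n α (ρ ^ k * R) := by
  have hV := unitBallVol_pos n
  set N := Real.sqrt (4 * K / (unitBallVol n * ρ ^ n)) with hN
  have hN0 : 0 ≤ N := Real.sqrt_nonneg _
  have hN2 : N ^ 2 = 4 * K / (unitBallVol n * ρ ^ n) := Real.sq_sqrt (by positivity)
  have hρα : 0 < ρ ^ α := Real.rpow_pos_of_pos hρ α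
  have hρα1 : ρ ^ α < 1 := Real.rpow_lt_one hρ.le hρ1 hα
  set N' := N / (1 - ρ ^ α) with hN'
  refine ⟨2 * K + 2 * (N' ^ 2 * unitBallVol n), by positivity, ?_⟩
  intro Ψ x R hΨ hR hex
  choose y hy hosc using hex
  have hr : ∀ k : ℕ, 0 < ρ ^ k * R := fun k => by positivity
  have hpow : ∀ k : ℕ, (ρ ^ k * R) ^ α = R ^ α * (ρ ^ α) ^ k := fun k => by
    rw [Real.mul_rpow (by positivity) hR.le, Real.rpow_pow_comm hρ.le, mul_comm]
  have hsub : ∀ k, ball x (ρ ^ (k + 1) * R) ⊆ ball x (ρ ^ k * R) := fun k =>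
    ball_subset_ball (by
      rw [pow_succ]
      have := hr k
      nlinarith)
  have hstep : ∀ k, dist (Ψ (y k)) (Ψ (y (k + 1))) ≤ (N * R ^ α) * (ρ ^ α) ^ k := by
    intro k
    have h1 := norm_sub_sq_mul_le hΨ (Ψ (y (k + 1))) (Ψ (y k)) x (ρ ^ (k + 1) * R)
    have h2 := osc_mono hΨ (Ψ (y k)) (hsub k)
    have h3 := hosc k
    have h4 := hosc (k + 1)
    have h5 : campanatoScale n α (ρ ^ (k + 1) * R) ≤ campanatoScale n α (ρ ^ k * R) := by
      have e : ρ ^ (k + 1) * R = ρ * (ρ ^ k * R) := by ring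
      rw [e, campanatoScale_mul hρ.le (hr k).le]
      refine mul_le_of_le_one_left (campanatoScale_pos (hr k)).le ?_
      exact mul_le_one₀ (pow_le_one₀ hρ.le hρ1.le) (by positivity)
        (pow_le_one₀ hρα.le hρα1.le)
    have h6 := mul_le_mul_of_nonneg_left h5 hK
    rw [volume_real_ball x (hr _)] at h1
    have h7 : ‖Ψ (y k) - Ψ (y (k + 1))‖ ^ 2 * ((ρ ^ (k + 1) * R) ^ n * unitBallVol n) ≤
        4 * (K * campanatoScale n α (ρ ^ k * R)) := by linarith
    rw [dist_eq_norm, mul_assoc, ← hpow]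
    refine (sq_le_sq₀ (norm_nonneg _) (by have := hr k; positivity)).1 ?_
    have h8 : 0 < (ρ ^ k * R) ^ n := pow_pos (hr k) n
    rw [mul_pow, hN2, div_mul_eq_mul_div, le_div_iff₀ (by positivity)]
    refine le_of_mul_le_mul_right ?_ h8
    refine le_trans (le_of_eq ?_) (h7.trans (le_of_eq ?_))
    · ring
    · simp only [campanatoScale]; ring
  have hlim : Filter.Tendsto (fun k => Ψ (y k)) Filter.atTop (nhds (Ψ x)) := by
    refine (hΨ.tendsto x).comp ?_
    rw [tendsto_iff_dist_tendsto_zero]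
    have : Filter.Tendsto (fun k : ℕ => ρ ^ k * R) Filter.atTop (nhds (0 * R)) :=
      (tendsto_pow_atTop_nhds_zero_of_lt_one hρ.le hρ1).mul_const R
    rw [zero_mul] at this
    exact squeeze_zero (fun _ => dist_nonneg) (fun k => (mem_ball.1 (hy k)).le) this
  intro k
  have h1 := dist_le_of_le_geometric_of_tendsto _ _ hρα1 hstep hlim k
  have h2 : ‖Ψ (y k) - Ψ x‖ ≤ N' * (ρ ^ k * R) ^ α := by
    rw [← dist_eq_norm, hpow, hN']
    refine h1.trans (le_of_eq (by ring))
  have h3 := osc_le_of_osc hΨ (Ψ x) (Ψ (y k)) x (ρ ^ k * R)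
  have h4 := pow_le_pow_left₀ (norm_nonneg _) h2 2
  have h5 := hosc k
  rw [volume_real_ball x (hr k)] at h3
  have h6 : ‖Ψ (y k) - Ψ x‖ ^ 2 * ((ρ ^ k * R) ^ n * unitBallVol n) ≤
      (N' * (ρ ^ k * R) ^ α) ^ 2 * ((ρ ^ k * R) ^ n * unitBallVol n) := by
    have := hr k
    gcongr
  have h7 : (N' * (ρ ^ k * R) ^ α) ^ 2 * ((ρ ^ k * R) ^ n * unitBallVol n) =
      N' ^ 2 * unitBallVol n * campanatoScale n α (ρ ^ k * R) := by
    simp only [campanatoScale]; ring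
  linarith

lemma exists_holder_bound (n : ℕ) {α ρ K : ℝ} (hα : 0 < α) (hρ : 0 < ρ) (hρ1 : ρ < 1)
    (hK : 0 ≤ K) :
    ∃ N : ℝ, 0 ≤ N ∧ ∀ (Ψ : Rn n → E) (R : ℝ) (s : Set (Rn n)), Continuous Ψ → 0 < R →
      (∀ x ∈ s, ∀ k : ℕ, osc Ψ (Ψ x) x (ρ ^ k * R) ≤ K * campanatoScale n α (ρ ^ k * R)) →
      ∀ x ∈ s, ∀ x' ∈ s, dist x x' ≤ R / 2 → ‖Ψ x - Ψ x'‖ ≤ N * dist x x' ^ α := by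
  have hV := unitBallVol_pos n
  set N := Real.sqrt (4 * K * 2 ^ n / unitBallVol n) with hN
  have hN0 : 0 ≤ N := Real.sqrt_nonneg _
  have hN2 : N ^ 2 = 4 * K * 2 ^ n / unitBallVol n := Real.sq_sqrt (by positivity)
  refine ⟨N * (2 / ρ) ^ α, by positivity, ?_⟩
  intro Ψ R s hΨ hR h x hx x' hx' hd
  rcases (dist_nonneg (x := x) (y := x')).eq_or_lt with h0 | h0
  · rw [dist_eq_zero.1 h0.symm]
    simp
    positivity
  set d := dist x x' with hdd
  obtain ⟨k, hk1, hk2⟩ := exists_nat_pow_near_of_lt_one (x := 2 * d / R) (y := ρ) (by positivity)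
    (by rw [div_le_one hR]; linarith) hρ hρ1
  rw [lt_div_iff₀ hR] at hk1
  rw [div_le_iff₀ hR] at hk2
  set r := ρ ^ k * R with hr
  have hr0 : 0 < r := by positivity
  have hsub1 : ball x (r / 2) ⊆ ball x r := ball_subset_ball (by linarith)
  have hsub2 : ball x (r / 2) ⊆ ball x' r := ball_subset_ball' (by linarith)
  have h1 := norm_sub_sq_mul_le hΨ (Ψ x') (Ψ x) x (r / 2)
  have h2 := osc_mono hΨ (Ψ x) hsub1
  have h3 := osc_mono hΨ (Ψ x') hsub2
  have h4 := h x hx k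
  have h5 := h x' hx' k
  rw [volume_real_ball x (by positivity)] at h1
  have h7 : ‖Ψ x - Ψ x'‖ ^ 2 * ((r / 2) ^ n * unitBallVol n) ≤
      4 * (K * campanatoScale n α r) := by linarith
  have h8 : ‖Ψ x - Ψ x'‖ ≤ N * r ^ α := by
    refine (sq_le_sq₀ (norm_nonneg _) (by positivity)).1 ?_
    have h8 : 0 < r ^ n := pow_pos hr0 n
    rw [mul_pow, hN2, div_mul_eq_mul_div, le_div_iff₀ hV]
    refine le_of_mul_le_mul_right ?_ h8
    rw [div_pow, div_mul_eq_mul_div, mul_div_assoc', div_le_iff₀ (by positivity)] at h7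
    refine le_trans (le_of_eq ?_) (h7.trans (le_of_eq ?_))
    · ring
    · simp only [campanatoScale]; ring
  have h9 : r ≤ 2 / ρ * d := by
    rw [div_mul_eq_mul_div, le_div_iff₀ hρ]
    rw [pow_succ] at hk1
    calc r * ρ = ρ ^ k * ρ * R := by rw [hr]; ring
      _ ≤ _ := by linarith
  calc ‖Ψ x - Ψ x'‖ ≤ N * r ^ α := h8
    _ ≤ N * (2 / ρ * d) ^ α := by gcongr
    _ = _ := by rw [Real.mul_rpow (by positivity) h0.le, mul_assoc]

end

section

variable {n : ℕ}

/-- The Hessian of `w` as a vector of a Euclidean space. -/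
def hessVec (w : Rn n → ℝ) (x : Rn n) : EuclideanSpace ℝ (Fin n × Fin n) :=
  WithLp.toLp 2 fun p => dd (stdVec p.1) (dd (stdVec p.2) w) x

lemma continuous_hessVec {w : Rn n → ℝ} (hw : ContDiff ℝ 2 w) : Continuous (hessVec w) := by
  refine (PiLp.continuous_toLp 2 _).comp (continuous_pi fun p => continuous_dd_dd hw _ _)

lemma osc_hessVec {w : Rn n → ℝ} (hw : ContDiff ℝ 2 w) (A : EuclideanSpace ℝ (Fin n × Fin n))
    (x : Rn n) (r : ℝ) : osc (hessVec w) A x r =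
      ∑ p : Fin n × Fin n, ∫ y in ball x r, (dd (stdVec p.1) (dd (stdVec p.2) w) y - A p) ^ 2 := by
  rw [osc, ← integral_finsetSum]
  · congr 1; funext y
    rw [EuclideanSpace.real_norm_sq_eq]
    rfl
  · intro p _
    have := continuous_dd_dd hw (stdVec p.1) (stdVec p.2)
    exact integrableOn_ball_of_continuous (by fun_prop) _ _

lemma exists_linear_decay_hessVec {a B : Matrix (Fin n) (Fin n) ℝ} {lam μ : ℝ}
    (hE : EllData a B lam μ) :
    ∃ C : ℝ, 0 < C ∧ ∀ (w : Rn n → ℝ) (x₀ : Rn n) (r ρ c : ℝ)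
      (A : EuclideanSpace ℝ (Fin n × Fin n)),
      ContDiff ℝ 2 w → HasCompactSupport w → 0 < r → 0 < ρ → ρ ≤ 1 / 4 →
      ∃ A', osc (hessVec w) A' x₀ (ρ * r) ≤ C * ρ ^ (n + 2) * osc (hessVec w) A x₀ r +
        C * ∫ y in ball x₀ r, (ellOp a w y - c) ^ 2 := by
  obtain ⟨C, hC, hlin⟩ := exists_linear_decay hE
  refine ⟨C + C * Fintype.card (Fin n × Fin n) + 1, by positivity, ?_⟩
  intro w x₀ r ρ c A hw hwc hr hρ hρ4
  choose A' hA' using fun p : Fin n × Fin n => hlin w x₀ r ρ (A p) c (stdVec p.1) (stdVec p.2)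
    hw hwc hr hρ hρ4 (norm_stdVec_le _) (norm_stdVec_le _)
  refine ⟨WithLp.toLp 2 A', ?_⟩
  have h1 := Finset.sum_le_sum fun p (_ : p ∈ Finset.univ) => hA' p
  rw [Finset.sum_add_distrib, ← Finset.mul_sum,
    ← osc_hessVec hw (WithLp.toLp 2 A'), ← osc_hessVec hw A, Finset.sum_const,
    Finset.card_univ, nsmul_eq_mul] at h1
  refine h1.trans ?_
  have hP : 0 ≤ ∫ y in ball x₀ r, (ellOp a w y - c) ^ 2 := integral_nonneg fun y => sq_nonneg _
  have hQ := osc_nonneg (hessVec w) A x₀ r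
  set P := ∫ y in ball x₀ r, (ellOp a w y - c) ^ 2
  set Q := osc (hessVec w) A x₀ r
  set m : ℝ := (Fintype.card (Fin n × Fin n) : ℝ)
  have hm : 0 ≤ m := Nat.cast_nonneg _
  have e1 : 0 ≤ (C * m + 1) * ρ ^ (n + 2) * Q := by positivity
  have e2 : 0 ≤ (C + 1) * P := by positivity
  linarith

lemma exists_small_ratio (C : ℝ) {α : ℝ} (hα1 : α < 1) :
    ∃ ρ : ℝ, 0 < ρ ∧ ρ ≤ 1 / 4 ∧ ∀ n : ℕ, 16 * (C * ρ ^ (n + 2)) ≤ campanatoScale n α ρ := by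
  have hlim : Filter.Tendsto (fun ρ : ℝ => 16 * C * (ρ ^ (1 - α)) ^ 2) (nhds 0)
      (nhds (16 * C * ((0 : ℝ) ^ (1 - α)) ^ 2)) :=
    (((Real.continuousAt_rpow_const 0 (1 - α) (Or.inr (by linarith))).pow 2).const_mul _)
  rw [Real.zero_rpow (by linarith)] at hlim
  norm_num at hlim
  have h1 := (hlim.eventually (gt_mem_nhds (zero_lt_one (α := ℝ)))).filter_mono
    (nhdsWithin_le_nhds (s := Ioi 0))
  have h2 : ∀ᶠ ρ : ℝ in nhdsWithin 0 (Ioi 0), ρ ∈ Ioo (0 : ℝ) (1 / 4) :=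
    Ioo_mem_nhdsGT (by norm_num)
  obtain ⟨ρ, hρ1, hρ2⟩ := (h1.and h2).exists
  refine ⟨ρ, hρ2.1, hρ2.2.le, fun n => ?_⟩
  have hρ := hρ2.1
  have e : ρ = ρ ^ (1 - α) * ρ ^ α := by
    rw [← Real.rpow_add hρ]; simp
  have e2 : ρ ^ 2 = (ρ ^ (1 - α)) ^ 2 * (ρ ^ α) ^ 2 := by
    conv_lhs => rw [e]
    rw [mul_pow]
  calc 16 * (C * ρ ^ (n + 2)) = 16 * C * (ρ ^ (1 - α)) ^ 2 * (ρ ^ n * (ρ ^ α) ^ 2) := by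
        rw [pow_add, e2]; ring
    _ ≤ 1 * (ρ ^ n * (ρ ^ α) ^ 2) := by
        have := Real.rpow_nonneg hρ.le α
        exact mul_le_mul_of_nonneg_right hρ1.le (by positivity)
    _ = _ := by rw [one_mul, campanatoScale]

/-- Hölder regularity of the Hessian when `ellOp a w` is Hölder continuous up to a small multiple of
the oscillation of the Hessian. -/
lemma exists_holder_of_ellOp {a B : Matrix (Fin n) (Fin n) ℝ} {lam μ α : ℝ}
    (hE : EllData a B lam μ) (hα : 0 < α) (hα1 : α < 1) :
    ∃ ε : ℝ, 0 < ε ∧ ∀ (w : Rn n → ℝ) (z₀ : Rn n) (R₀ M₁ : ℝ), ContDiff ℝ 2 w →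
      HasCompactSupport w → 0 < R₀ → 0 ≤ M₁ →
      (∀ x ∈ ball z₀ R₀, ∀ y ∈ ball z₀ R₀,
        |ellOp a w x - ellOp a w y| ≤ M₁ * dist x y ^ α + ε * ‖hessVec w x - hessVec w y‖) →
      ∃ N : ℝ, 0 ≤ N ∧ ∀ x ∈ ball z₀ (R₀ / 8), ∀ x' ∈ ball z₀ (R₀ / 8),
        ‖hessVec w x - hessVec w x'‖ ≤ N * dist x x' ^ α := by
  obtain ⟨C, hC, hlin⟩ := exists_linear_decay_hessVec hE
  obtain ⟨ρ, hρ, hρ4, hρs⟩ := exists_small_ratio C hα1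
  have hρ1 : ρ < 1 := by linarith
  have hS := campanatoScale_pos (n := n) (α := α) hρ
  set S := campanatoScale n α ρ with hSdef
  set ε := Real.sqrt (S / (32 * C)) with hε
  have hε0 : 0 < ε := Real.sqrt_pos.2 (by positivity)
  have hε2 : ε ^ 2 = S / (32 * C) := Real.sq_sqrt (by positivity)
  refine ⟨ε, hε0, ?_⟩
  intro w z₀ R₀ M₁ hw hwc hR₀ hM₁ hL
  have hV := unitBallVol_pos n
  set Ψ := hessVec w with hΨdef
  have hΨ : Continuous Ψ := continuous_hessVec hw
  have hLC := continuous_ellOp hw a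
  set M := C * (2 * (M₁ ^ 2 * ((2 : ℝ) ^ α) ^ 2) * unitBallVol n) with hM
  have hM0 : 0 ≤ M := by positivity
  set θ := C * ρ ^ (n + 2) + C * (2 * ε ^ 2) with hθ
  set R := R₀ / 2 with hR
  have hR0 : 0 < R := by positivity
  obtain ⟨b, hb⟩ := (isCompact_closedBall z₀ R₀).exists_bound_of_continuousOn hΨ.continuousOn
  have hSR := campanatoScale_pos (n := n) (α := α) hR0
  set K := 8 * M / S + (2 * b) ^ 2 * (R ^ n * unitBallVol n) / campanatoScale n α R with hK
  have hK0 : 0 ≤ K := by positivity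
  obtain ⟨K', hK'0, hK'⟩ := exists_campanato_bound (E := EuclideanSpace ℝ (Fin n × Fin n)) n hα hρ
    hρ1 hK0
  obtain ⟨N, hN0, hN⟩ := exists_holder_bound (E := EuclideanSpace ℝ (Fin n × Fin n)) n hα hρ
    hρ1 hK'0
  refine ⟨N, hN0, ?_⟩
  intro x hx x' hx'
  have hd : dist x x' ≤ R / 2 := by
    have h1 := dist_triangle_right x x' z₀
    have h2 := mem_ball.1 hx
    have h3 := mem_ball.1 hx'
    rw [hR]; linarith
  refine hN Ψ R (ball z₀ (R₀ / 8)) hΨ hR0 (fun x hx => ?_) x hx x' hx' hd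
  have hsub : ball x R ⊆ ball z₀ R₀ := ball_subset_ball' (by
    have := mem_ball.1 hx
    rw [hR]; linarith)
  refine hK' Ψ x R hΨ hR0 (exists_osc_le_scale hΨ (θ := θ) (M := M) hρ hρ1 hR0
    (by positivity) hK0 ?_ ?_ ?_ ?_)
  · have h1 := hρs n
    have h2 : C * (2 * ε ^ 2) = S / 16 := by rw [hε2]; field_simp; norm_num
    rw [hθ, h2]
    linarith
  · rw [hK, add_mul, div_mul_cancel₀ _ hS.ne']
    have : 0 ≤ (2 * b) ^ 2 * (R ^ n * unitBallVol n) / campanatoScale n α R * S := by positivity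
    linarith
  · intro r hr hrR y hy
    obtain ⟨A', hA'⟩ := hlin w x r ρ (ellOp a w y) (Ψ y) hw hwc hr hρ hρ4
    refine ⟨A', hA'.trans ?_⟩
    have hsub' : ball x r ⊆ ball z₀ R₀ := (ball_subset_ball hrR).trans hsub
    have h1 : ∫ z in ball x r, (ellOp a w z - ellOp a w y) ^ 2 ≤
        ∫ z in ball x r, (2 * (M₁ ^ 2 * ((2 : ℝ) ^ α * r ^ α) ^ 2) +
          2 * ε ^ 2 * ‖Ψ z - Ψ y‖ ^ 2) := by
      refine setIntegral_mono_on (integrableOn_ball_of_continuous (by fun_prop) _ _)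
        (integrableOn_ball_of_continuous (by fun_prop) _ _) measurableSet_ball fun z hz => ?_
      have h2 := hL z (hsub' hz) y (hsub' hy)
      have h3 : dist z y ^ α ≤ (2 : ℝ) ^ α * r ^ α := by
        rw [← Real.mul_rpow (by norm_num) hr.le]
        refine Real.rpow_le_rpow dist_nonneg ?_ hα.le
        have h1 := dist_triangle_right z y x
        have h2 := mem_ball.1 hz
        have h3 := mem_ball.1 hy
        linarith
      have h4 : |ellOp a w z - ellOp a w y| ≤ M₁ * ((2 : ℝ) ^ α * r ^ α) + ε * ‖Ψ z - Ψ y‖ :=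
        h2.trans (by gcongr)
      have h5 := pow_le_pow_left₀ (abs_nonneg _) h4 2
      rw [sq_abs] at h5
      nlinarith [sq_nonneg (M₁ * ((2 : ℝ) ^ α * r ^ α) - ε * ‖Ψ z - Ψ y‖)]
    rw [integral_add (integrableOn_ball_of_continuous (by fun_prop) _ _)
      (integrableOn_ball_of_continuous (by fun_prop) _ _), setIntegral_const, integral_const_mul,
      volume_real_ball x hr, smul_eq_mul] at h1
    change _ ≤ _ + 2 * ε ^ 2 * osc Ψ (Ψ y) x r at h1
    have h2 := mul_le_mul_of_nonneg_left h1 hC.le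
    have h3 : M * campanatoScale n α r = C * (r ^ n * unitBallVol n *
        (2 * (M₁ ^ 2 * ((2 : ℝ) ^ α * r ^ α) ^ 2))) := by
      rw [hM, campanatoScale]; ring
    rw [h3, hθ]
    linarith
  · refine ⟨x, mem_ball_self hR0, ?_⟩
    have h1 : osc Ψ (Ψ x) x R ≤ (2 * b) ^ 2 * (R ^ n * unitBallVol n) := by
      have : osc Ψ (Ψ x) x R ≤ ∫ y in ball x R, (2 * b) ^ 2 := by
        refine setIntegral_mono_on (integrableOn_ball_of_continuous (by fun_prop) _ _)
          (integrableOn_ball_of_continuous (by fun_prop) _ _) measurableSet_ball fun z hz => ?_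
        refine pow_le_pow_left₀ (norm_nonneg _) ?_ 2
        have h1 := norm_sub_le (Ψ z) (Ψ x)
        have h2 := hb z (ball_subset_closedBall (hsub hz))
        have h3 := hb x (ball_subset_closedBall (hsub (mem_ball_self hR0)))
        linarith
      rwa [setIntegral_const, volume_real_ball x hR0, smul_eq_mul, mul_comm] at this
    refine h1.trans ?_
    rw [hK, add_mul, div_mul_cancel₀ _ hSR.ne']
    have : 0 ≤ 8 * M / S * campanatoScale n α R := by positivity
    linarith

end

section

open scoped ContDiff

variable {n : ℕ}

lemma quadForm_eq_dotProduct (M : Matrix (Fin n) (Fin n) ℝ) (ξ : Rn n) :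
    quadForm M ξ = star (ξ : Fin n → ℝ) ⬝ᵥ (M.mulVec ξ) := by
  simp only [quadForm, dotProduct, Matrix.mulVec, Finset.mul_sum, Pi.star_apply, star_trivial]
  exact Finset.sum_congr rfl fun i _ => Finset.sum_congr rfl fun j _ => by ring

lemma exists_coercive_of_posDef {M : Matrix (Fin n) (Fin n) ℝ} (hM : M.PosDef) :
    ∃ lam : ℝ, 0 < lam ∧ ∀ ξ : Rn n, lam * ‖ξ‖ ^ 2 ≤ quadForm M ξ := by
  have hpos : ∀ ξ : Rn n, ξ ≠ 0 → 0 < quadForm M ξ := by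
    intro ξ hξ
    rw [quadForm_eq_dotProduct]
    refine (Matrix.posDef_iff_dotProduct_mulVec.1 hM).2 (x := (ξ : Fin n → ℝ)) fun h => hξ ?_
    ext i
    exact congrFun h i
  have hcont : Continuous (quadForm M) := by
    unfold quadForm
    fun_prop
  rcases (sphere (0 : Rn n) 1).eq_empty_or_nonempty with he | hne
  · refine ⟨1, one_pos, fun ξ => ?_⟩
    have : ξ = 0 := by
      by_contra h
      have h2 : ‖ξ‖⁻¹ • ξ ∈ sphere (0 : Rn n) 1 := by
        simp [norm_smul, inv_mul_cancel₀ (norm_ne_zero_iff.2 h)]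
      rw [he] at h2
      exact h2
    simp [this, quadForm]
  · obtain ⟨ζ, hζ, hmin⟩ := (isCompact_sphere (0 : Rn n) 1).exists_isMinOn hne hcont.continuousOn
    refine ⟨quadForm M ζ, hpos ζ (fun h => by simp [h] at hζ), fun ξ => ?_⟩
    by_cases h : ξ = 0
    · simp [h, quadForm]
    · have h0 : 0 < ‖ξ‖ := norm_pos_iff.2 h
      have h2 : ‖ξ‖⁻¹ • ξ ∈ sphere (0 : Rn n) 1 := by
        simp [norm_smul, inv_mul_cancel₀ h0.ne']
      have h3 : quadForm M ζ ≤ quadForm M (‖ξ‖⁻¹ • ξ) := hmin h2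
      have h4 : quadForm M (‖ξ‖⁻¹ • ξ) = (‖ξ‖⁻¹) ^ 2 * quadForm M ξ := by
        simp only [quadForm, Finset.mul_sum, PiLp.smul_apply, smul_eq_mul]
        exact Finset.sum_congr rfl fun i _ => Finset.sum_congr rfl fun j _ => by ring
      rw [h4] at h3
      calc quadForm M ζ * ‖ξ‖ ^ 2 ≤ (‖ξ‖⁻¹) ^ 2 * quadForm M ξ * ‖ξ‖ ^ 2 := by gcongr
        _ = _ := by field_simp

lemma exists_ellData_of_posDef {B : Matrix (Fin n) (Fin n) ℝ} (hB : B.PosDef) :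
    ∃ lam μ : ℝ, EllData B⁻¹ B lam μ := by
  obtain ⟨lam, hlam, h1⟩ := exists_coercive_of_posDef hB.inv
  obtain ⟨μ, hμ, h2⟩ := exists_coercive_of_posDef hB
  have hs : ∀ i j, B i j = B j i := fun i j => by
    simpa using (hB.isHermitian.apply i j).symm
  have hs' : ∀ i j, B⁻¹ i j = B⁻¹ j i := fun i j => by
    simpa using (hB.inv.isHermitian.apply i j).symm
  refine ⟨lam, μ, hs, fun j k => ?_, hlam, h1, hμ, h2⟩
  have h3 : B⁻¹ * B = 1 := Matrix.nonsing_inv_mul B (isUnit_iff_ne_zero.2 hB.det_pos.ne')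
  have h4 := congrFun (congrFun h3 j) k
  rw [Matrix.mul_apply, Matrix.one_apply] at h4
  rw [← h4]
  exact Finset.sum_congr rfl fun i _ => by rw [hs']

/-- A square matrix read off from a vector of entries. -/
def matOfVec (m : EuclideanSpace ℝ (Fin n × Fin n)) : Matrix (Fin n) (Fin n) ℝ :=
  fun i j => m (i, j)

lemma contDiff_det_matOfVec : ContDiff ℝ ∞
    (fun m : EuclideanSpace ℝ (Fin n × Fin n) => (matOfVec m).det) := by
  simp only [Matrix.det_apply, matOfVec]
  refine ContDiff.sum fun σ _ => ContDiff.const_smul _ (contDiff_prod fun i _ => ?_)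
  fun_prop

lemma hasDerivAt_det_add_smul {B : Matrix (Fin n) (Fin n) ℝ} (hB : IsUnit B.det)
    (N : Matrix (Fin n) (Fin n) ℝ) :
    HasDerivAt (fun t : ℝ => (B + t • N).det) (B.det * (B⁻¹ * N).trace) 0 := by
  have e : ∀ t : ℝ, (B + t • N).det = B.det * (1 + (B⁻¹ * N).trace * t +
      (Matrix.det (1 + (Polynomial.X : Polynomial ℝ) •
        (B⁻¹ * N).map Polynomial.C)).divX.divX.eval t * t ^ 2) := by
    intro t
    rw [← Matrix.det_one_add_smul, ← Matrix.det_mul, mul_add, mul_one, Matrix.mul_smul,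
      Matrix.mul_nonsing_inv_cancel_left B N hB]
  simp_rw [e]
  set q := (Matrix.det (1 + (Polynomial.X : Polynomial ℝ) •
        (B⁻¹ * N).map Polynomial.C)).divX.divX
  have h1 := (q.hasDerivAt 0).mul ((hasDerivAt_id (0 : ℝ)).pow 2)
  have h2 := (((hasDerivAt_id (0 : ℝ)).const_mul (B⁻¹ * N).trace).const_add 1).add h1
  have h3 := h2.const_mul B.det
  simpa using h3

/-- Near `b`, the determinant is uniformly close to its linearisation at `b`. -/
lemma eventually_det_linearization {b : EuclideanSpace ℝ (Fin n × Fin n)}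
    (hB : IsUnit (matOfVec b).det) {ε : ℝ} (hε : 0 < ε) :
    ∀ᶠ p in nhds (b, b),
      |(matOfVec p.1).det - (matOfVec p.2).det -
        (matOfVec b).det * ((matOfVec b)⁻¹ * matOfVec (p.1 - p.2)).trace| ≤ ε * ‖p.1 - p.2‖ := by
  have h1 := (contDiff_det_matOfVec (n := n)).contDiffAt.hasStrictFDerivAt (x := b) (by simp)
  set F' := fderiv ℝ (fun m : EuclideanSpace ℝ (Fin n × Fin n) => (matOfVec m).det) b
  have hF' : ∀ N, F' N = (matOfVec b).det * ((matOfVec b)⁻¹ * matOfVec N).trace := by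
    intro N
    have h2 := hasDerivAt_det_add_smul hB (matOfVec N)
    have h3 : HasDerivAt (fun t : ℝ => b + t • N) N 0 := by
      simpa using ((hasDerivAt_id (0 : ℝ)).smul_const N).const_add b
    have h4 : HasFDerivAt (fun m : EuclideanSpace ℝ (Fin n × Fin n) => (matOfVec m).det) F'
        (b + (0 : ℝ) • N) := by
      rw [zero_smul, add_zero]; exact h1.hasFDerivAt
    have h5 := HasFDerivAt.comp_hasDerivAt (0 : ℝ) h4 h3
    exact h5.unique h2
  filter_upwards [h1.isLittleO.def hε] with p hp
  rw [← hF']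
  exact hp

lemma trace_inv_mul_eq {B : Matrix (Fin n) (Fin n) ℝ} (hB : B.PosDef) {w : Rn n → ℝ} (x y : Rn n) :
    (B⁻¹ * matOfVec (hessVec w x - hessVec w y)).trace = ellOp B⁻¹ w x - ellOp B⁻¹ w y := by
  have hs' : ∀ i j, B⁻¹ i j = B⁻¹ j i := fun i j => by
    simpa using (hB.inv.isHermitian.apply i j).symm
  simp only [Matrix.trace, Matrix.diag_apply, Matrix.mul_apply, ellOp, ← Finset.sum_sub_distrib]
  rw [Finset.sum_comm]
  refine Finset.sum_congr rfl fun i _ => Finset.sum_congr rfl fun j _ => ?_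
  rw [hs', ← mul_sub]
  rfl

lemma realHessian_eq_matOfVec {w : Rn n → ℝ} (hw : ContDiff ℝ 2 w) (x : Rn n) :
    realHessian w x = matOfVec (hessVec w x) := by
  ext i j
  exact (dd_dd_eq hw _ _ x).symm

lemma D2_eq_quadForm (w : Rn n → ℝ) (x ξ : Rn n) : D2 w x ξ ξ = quadForm (realHessian w x) ξ := by
  have h : D2 w x (∑ i, ξ i • stdVec i) (∑ i, ξ i • stdVec i) = quadForm (realHessian w x) ξ := by
    simp only [D2, map_sum, map_smul, sum_apply, smul_apply, smul_eq_mul, quadForm, realHessian,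
      Finset.mul_sum]
    refine Finset.sum_comm.trans
      (Finset.sum_congr rfl fun i _ => Finset.sum_congr rfl fun j _ => ?_)
    simp only [stdVec]
    ring
  rwa [sum_smul_stdVec] at h

lemma D2_nonneg_of_convexOn {w : Rn n → ℝ} (hw : ContDiff ℝ 2 w) {z : Rn n} {r : ℝ} (hr : 0 < r)
    (hc : ConvexOn ℝ (ball z r) w) (v : Rn n) : 0 ≤ D2 w z v v := by
  let g : ℝ →ᵃ[ℝ] Rn n := AffineMap.lineMap z (z + v)
  have hg : ∀ t : ℝ, g t = z + t • v := fun t => by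
    simp [g, AffineMap.lineMap_apply, add_comm]
  have hgd : ∀ t : ℝ, HasDerivAt g v t := fun t => by
    have : HasDerivAt (fun t : ℝ => z + t • v) v t := by
      simpa using ((hasDerivAt_id t).smul_const v).const_add z
    exact this.congr_of_eventuallyEq (Filter.Eventually.of_forall hg)
  have hdw : ContDiff ℝ 1 (dd v w) := contDiff_dd (k := 1) v (by norm_num; exact hw)
  have h1 : ∀ t, HasDerivAt (w ∘ g) (dd v w (g t)) t := fun t =>
    ((hw.differentiable (by simp)) (g t)).hasFDerivAt.comp_hasDerivAt t (hgd t)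
  have h2 : HasDerivAt (fun t => dd v w (g t)) (dd v (dd v w) z) 0 := by
    have := ((hdw.differentiable (by simp)) (g 0)).hasFDerivAt.comp_hasDerivAt 0 (hgd 0)
    simpa [hg, dd, Function.comp_def] using this
  have hd : deriv (w ∘ g) = fun t => dd v w (g t) := funext fun t => (h1 t).deriv
  have hmono := (hc.comp_affineMap g).monotoneOn_deriv fun t _ => (h1 t).differentiableAt
  rw [hd] at hmono
  have hopen : IsOpen (g ⁻¹' ball z r) :=
    isOpen_ball.preimage (continuous_iff_continuousAt.2 fun t => (hgd t).continuousAt)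
  have h0 : (0 : ℝ) ∈ g ⁻¹' ball z r := by
    rw [mem_preimage, hg]
    simpa using hr
  have h3 := hmono.derivWithin_nonneg (x := 0)
  rwa [derivWithin_of_isOpen hopen h0, h2.deriv, dd_dd_eq hw] at h3

lemma posDef_realHessian {w : Rn n → ℝ} (hw : ContDiff ℝ 2 w) {z : Rn n} {r : ℝ} (hr : 0 < r)
    (hc : ConvexOn ℝ (ball z r) w) (hdet : (realHessian w z).det ≠ 0) :
    (realHessian w z).PosDef := by
  have hsd : (realHessian w z).PosSemidef := by
    refine Matrix.posSemidef_iff_dotProduct_mulVec.2 ⟨?_, fun x => ?_⟩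
    · ext i j
      simp only [Matrix.conjTranspose_apply, star_trivial]
      exact (hw.contDiffAt.isSymmSndFDerivAt (by simp)) _ _
    · have := D2_nonneg_of_convexOn hw hr hc (WithLp.toLp 2 x)
      rwa [D2_eq_quadForm, quadForm_eq_dotProduct] at this
  exact hsd.posDef_iff_isUnit.2 ((Matrix.isUnit_iff_isUnit_det _).2 (isUnit_iff_ne_zero.2 hdet))

end

section

variable {n : ℕ}

lemma norm_fderiv_fderiv_sub_le {w : Rn n → ℝ} (hw : ContDiff ℝ 2 w) (x y : Rn n) :
    ‖fderiv ℝ (fderiv ℝ w) x - fderiv ℝ (fderiv ℝ w) y‖ ≤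
      (n : ℝ) ^ 2 * ‖hessVec w x - hessVec w y‖ := by
  refine ContinuousLinearMap.opNorm_le_bound₂ _ (by positivity) fun p q => ?_
  set T := fderiv ℝ (fderiv ℝ w) x - fderiv ℝ (fderiv ℝ w) y
  set H := hessVec w x - hessVec w y
  have hT : ∀ i j, T (stdVec i) (stdVec j) = H (i, j) := by
    intro i j
    change D2 w x (stdVec i) (stdVec j) - D2 w y (stdVec i) (stdVec j) =
      dd (stdVec i) (dd (stdVec j) w) x - dd (stdVec i) (dd (stdVec j) w) y
    rw [dd_dd_eq hw, dd_dd_eq hw]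
  have hexp : T p q = ∑ i, ∑ j, p i * q j * H (i, j) := by
    conv_lhs => rw [← sum_smul_stdVec p, ← sum_smul_stdVec q]
    simp only [map_sum, map_smul, sum_apply, smul_apply, smul_eq_mul, hT, Finset.mul_sum]
    refine Finset.sum_comm.trans
      (Finset.sum_congr rfl fun i _ => Finset.sum_congr rfl fun j _ => ?_)
    ring
  rw [hexp]
  calc ‖∑ i, ∑ j, p i * q j * H (i, j)‖ ≤ ∑ i, ∑ j, ‖p i * q j * H (i, j)‖ :=
        (norm_sum_le _ _).trans (Finset.sum_le_sum fun i _ => norm_sum_le _ _)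
    _ ≤ ∑ _i : Fin n, ∑ _j : Fin n, ‖p‖ * ‖q‖ * ‖H‖ := by
        gcongr with i _ j _
        rw [norm_mul, norm_mul]
        gcongr
        · exact PiLp.norm_apply_le p i
        · exact PiLp.norm_apply_le q j
        · exact PiLp.norm_apply_le H (i, j)
    _ = (n : ℝ) ^ 2 * ‖H‖ * ‖p‖ * ‖q‖ := by
        simp only [Finset.sum_const, Finset.card_univ, Fintype.card_fin, nsmul_eq_mul]
        ring

/-- A `C²` function on an open set agrees near any point with a compactly supported `C²` function
on the whole space. -/
lemma exists_contDiff_hasCompactSupport_eqOn {Ω : Set (Rn n)} (hΩ : IsOpen Ω) {u : Rn n → ℝ}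
    (hu : ContDiffOn ℝ 2 u Ω) {z : Rn n} (hz : z ∈ Ω) :
    ∃ w : Rn n → ℝ, ContDiff ℝ 2 w ∧ HasCompactSupport w ∧
      ∃ r > 0, ball z r ⊆ Ω ∧ EqOn w u (ball z r) := by
  obtain ⟨δ, hδ, hsub⟩ := Metric.nhds_basis_closedBall.mem_iff.1 (hΩ.mem_nhds hz)
  let χ : ContDiffBump z := ⟨δ / 2, δ, by positivity, by linarith⟩
  refine ⟨fun x => χ x * u x, contDiff_iff_contDiffAt.2 fun x => ?_,
    χ.hasCompactSupport.mul_right, δ / 2, by positivity,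
    (ball_subset_ball (by linarith)).trans (ball_subset_closedBall.trans hsub), fun x hx => ?_⟩
  · by_cases hx : x ∈ Ω
    · exact χ.contDiffAt.mul (hu.contDiffAt (hΩ.mem_nhds hx))
    · have hx' : x ∉ tsupport χ := fun h => hx (hsub (by rwa [χ.tsupport_eq] at h))
      refine contDiffAt_const (c := (0 : ℝ)) |>.congr_of_eventuallyEq ?_
      filter_upwards [notMem_tsupport_iff_eventuallyEq.1 hx'] with y hy
      simp [hy]
  · simp only
    rw [χ.one_of_mem_closedBall (ball_subset_closedBall hx), one_mul]

lemma fderiv_fderiv_eqOn {w u : Rn n → ℝ} {s : Set (Rn n)} (hs : IsOpen s) (h : EqOn w u s) :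
    EqOn (fderiv ℝ (fderiv ℝ w)) (fderiv ℝ (fderiv ℝ u)) s := fun _ hx =>
  (h.eventuallyEq_of_mem (hs.mem_nhds hx)).fderiv.fderiv_eq

end

end MongeAmpere

open MongeAmpere

/-- **Caffarelli's interior `C^{2,α}` regularity for the real Monge–Ampère equation.**
Let `Ω ⊆ ℝⁿ` be a bounded convex domain and `u` a convex function, continuous on the
closure of `Ω` and twice continuously differentiable in `Ω`, satisfying
`det(D²u) = f` in `Ω`, where `f ≥ λ > 0` and `f` is `α`-Hölder continuous on `Ω` for
some `α ∈ (0,1)`, and `u = 0` on `∂Ω`. Then `u ∈ C^{2,α}(Ω)`: all second order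
derivatives of `u` are locally `α`-Hölder continuous in `Ω`. -/
theorem caffarelli_interior_C2alpha_real_MongeAmpere
    {n : ℕ} (Ω : Set (Rn n)) (hΩo : IsOpen Ω) (hΩconv : Convex ℝ Ω)
    (hΩbd : Bornology.IsBounded Ω) (hΩne : Ω.Nonempty)
    (u f : Rn n → ℝ) (α : NNReal) (hα : 0 < α) (hα1 : α < 1)
    (lam : ℝ) (hlam : 0 < lam)
    (hucont : ContinuousOn u (closure Ω)) (hucvx : ConvexOn ℝ Ω u)
    (hu2 : ContDiffOn ℝ 2 u Ω)
    (hMA : ∀ z ∈ Ω, (realHessian u z).det = f z)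
    (hflam : ∀ z ∈ Ω, lam ≤ f z)
    (hf : ∃ C : NNReal, HolderOnWith C α f Ω)
    (hbdry : ∀ z ∈ frontier Ω, u z = 0) :
    ContDiffOn ℝ 2 u Ω ∧
      ∀ z ∈ Ω, ∃ ε > 0, ball z ε ⊆ Ω ∧
        ∃ C : NNReal, HolderOnWith C α (fun x => fderiv ℝ (fderiv ℝ u) x) (ball z ε) := by
  refine ⟨hu2, fun z hz => ?_⟩
  obtain ⟨w, hw, hwc, r, hr, hrΩ, hwu⟩ := exists_contDiff_hasCompactSupport_eqOn hΩo hu2 hz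
  obtain ⟨C, hC⟩ := hf
  have hD := fderiv_fderiv_eqOn isOpen_ball hwu
  have hdet : ∀ x ∈ ball z r, (matOfVec (hessVec w x)).det = f x := by
    intro x hx
    rw [← realHessian_eq_matOfVec hw, ← hMA x (hrΩ hx)]
    congr 1
    ext i j
    exact congrArg (fun T : Rn n →L[ℝ] Rn n →L[ℝ] ℝ => T (EuclideanSpace.single i 1)
      (EuclideanSpace.single j 1)) (hD hx)
  have hwcvx : ConvexOn ℝ (ball z r) w :=
    (hucvx.subset hrΩ (convex_ball z r)).congr hwu.symm
  have hzr : z ∈ ball z r := mem_ball_self hr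
  have hfz : 0 < f z := hlam.trans_le (hflam z hz)
  have hB : (matOfVec (hessVec w z)).PosDef := by
    rw [← realHessian_eq_matOfVec hw]
    refine posDef_realHessian hw hr hwcvx ?_
    rw [realHessian_eq_matOfVec hw, hdet z hzr]
    exact hfz.ne'
  obtain ⟨l, μ, hE⟩ := exists_ellData_of_posDef hB
  obtain ⟨ε, hε, hmain⟩ := exists_holder_of_ellOp hE (α := (α : ℝ)) (by exact_mod_cast hα)
    (by exact_mod_cast hα1)
  have hunit : IsUnit (matOfVec (hessVec w z)).det := isUnit_iff_ne_zero.2 hB.det_pos.ne'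
  have hcts : Continuous fun p : Rn n × Rn n => (hessVec w p.1, hessVec w p.2) :=
    ((continuous_hessVec hw).comp continuous_fst).prodMk
      ((continuous_hessVec hw).comp continuous_snd)
  have hlin := (hcts.tendsto (z, z)).eventually
    (eventually_det_linearization hunit (mul_pos hε hfz))
  obtain ⟨ρ, hρ, hlin⟩ := Metric.eventually_nhds_iff_ball.1 hlin
  set R := min ρ r
  have hR : 0 < R := lt_min hρ hr
  obtain ⟨N, hN, hhold⟩ := hmain w z R (C / f z) hw hwc hR (by positivity) (by
    intro x hx y hy
    have hxr : x ∈ ball z r := ball_subset_ball (min_le_right _ _) hx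
    have hyr : y ∈ ball z r := ball_subset_ball (min_le_right _ _) hy
    have h1 := hlin (x, y) (by
      rw [← ball_prod_same]
      exact ⟨ball_subset_ball (min_le_left _ _) hx, ball_subset_ball (min_le_left _ _) hy⟩)
    simp only [hdet x hxr, hdet y hyr, hdet z hzr, trace_inv_mul_eq hB] at h1
    have h2 := hC.dist_le (hrΩ hxr) (hrΩ hyr)
    rw [Real.dist_eq] at h2
    set e := ellOp (matOfVec (hessVec w z))⁻¹ w x - ellOp (matOfVec (hessVec w z))⁻¹ w y
    have h3 : f z * |e| ≤ C * dist x y ^ (α : ℝ) + ε * f z * ‖hessVec w x - hessVec w y‖ := by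
      rw [← abs_of_pos hfz, ← abs_mul, abs_of_pos hfz]
      have := abs_sub_abs_le_abs_sub (f z * e) (f x - f y)
      rw [abs_sub_comm (f z * e)] at this
      linarith
    refine le_of_mul_le_mul_left (h3.trans_eq ?_) hfz
    field_simp)
  refine ⟨R / 8, by positivity,
    (ball_subset_ball (by have := min_le_right ρ r; change R / 8 ≤ r; linarith)).trans hrΩ,
    ⟨(n : ℝ) ^ 2 * N, by positivity⟩, fun x hx y hy => ?_⟩
  have hxr : x ∈ ball z r :=
    ball_subset_ball (by have := min_le_right ρ r; change R / 8 ≤ r; linarith) hx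
  have hyr : y ∈ ball z r :=
    ball_subset_ball (by have := min_le_right ρ r; change R / 8 ≤ r; linarith) hy
  have h1 : dist (fderiv ℝ (fderiv ℝ u) x) (fderiv ℝ (fderiv ℝ u) y) ≤
      ((n : ℝ) ^ 2 * N) * dist x y ^ (α : ℝ) := by
    rw [← hD hxr, ← hD hyr]
    refine (dist_eq_norm (fderiv ℝ (fderiv ℝ w) x) (fderiv ℝ (fderiv ℝ w) y)).trans_le ((norm_fderiv_fderiv_sub_le hw x y).trans ?_)
    rw [mul_assoc]
    gcongr
    exact hhold x hx y hy
  rw [edist_dist, edist_dist, ENNReal.ofReal_rpow_of_nonneg dist_nonneg α.coe_nonneg]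
  refine (ENNReal.ofReal_le_ofReal h1).trans_eq ?_
  rw [ENNReal.ofReal_mul (by positivity)]
  congr 1
  exact ENNReal.ofReal_eq_coe_nnreal _
end
end

section
/- Let A and B be n×n Hermitian positive definite matrices. Then log det A − log det B = Σ_{i,j=1}^{n} M_{j i} · (A − B)_{i j}, where M = ∫₀¹ (t·A + (1−t)·B)^{-1} dt is the entrywise integral of the inverse of the segment joining B to A. Equivalently, log det A − log det B equals the trace of (∫₀¹ (t A + (1−t) B)^{-1} dt) · (A − B). -/
open scoped ComplexOrder

open Polynomial in
/-- Jacobi's formula along a line: the derivative of `det (P + z • D)` at `z = 0`. -/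
theorem Matrix.hasDerivAt_det_add_smul_zero {m 𝕜 : Type*} [Fintype m] [DecidableEq m]
    [NontriviallyNormedField 𝕜] {P : Matrix m m 𝕜} (hP : IsUnit P.det) (D : Matrix m m 𝕜) :
    HasDerivAt (fun z : 𝕜 => (P + z • D).det) (P.det * (P⁻¹ * D).trace) 0 := by
  have hfactor (z : 𝕜) : (P + z • D).det = P.det * (1 + (P⁻¹ * D).trace * z +
      (det (1 + (X : 𝕜[X]) • (P⁻¹ * D).map C)).divX.divX.eval z * z ^ 2) := by
    rw [← Matrix.det_one_add_smul, ← Matrix.det_mul, mul_add, mul_one, Matrix.mul_smul,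
      Matrix.mul_nonsing_inv_cancel_left _ _ hP]
  simp_rw [hfactor]
  generalize (det (1 + (X : 𝕜[X]) • (P⁻¹ * D).map C)).divX.divX = q
  refine HasDerivAt.const_mul _ ?_
  have h := (((hasDerivAt_id (0 : 𝕜)).const_mul (P⁻¹ * D).trace).const_add 1).add
    ((q.hasDerivAt 0).mul ((hasDerivAt_id (0 : 𝕜)).pow 2))
  convert! h using 1
  simp

/-- Jacobi's formula along the line through `B` and `A`. -/
theorem Matrix.hasDerivAt_det_segment {m 𝕜 : Type*} [Fintype m] [DecidableEq m]
    [NontriviallyNormedField 𝕜] (A B : Matrix m m 𝕜) {w : 𝕜}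
    (hw : IsUnit (w • A + (1 - w) • B).det) :
    HasDerivAt (fun z : 𝕜 => (z • A + (1 - z) • B).det)
      ((w • A + (1 - w) • B).det * ((w • A + (1 - w) • B)⁻¹ * (A - B)).trace) w := by
  have h := Matrix.hasDerivAt_det_add_smul_zero hw (A - B)
  rw [← sub_self w] at h
  convert! h.comp_sub_const w w using 1
  funext z
  congr 1
  module

theorem Matrix.PosDef.segment {m : Type*} [Finite m] {A B : Matrix m m ℂ}
    (hA : A.PosDef) (hB : B.PosDef) {t : ℝ} (ht : t ∈ Set.Icc (0 : ℝ) 1) :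
    ((t : ℂ) • A + ((1 - t : ℝ) : ℂ) • B).PosDef := by
  rcases ht.1.eq_or_lt with rfl | h0
  · simpa using hB
  · have h1 : (0 : ℂ) ≤ ((1 - t : ℝ) : ℂ) := by
      exact_mod_cast sub_nonneg.mpr ht.2
    exact (hA.smul (by exact_mod_cast h0)).add_posSemidef (hB.posSemidef.smul h1)

theorem Matrix.PosDef.log_det_eq_ofReal {m : Type*} [Fintype m] [DecidableEq m]
    {A : Matrix m m ℂ} (hA : A.PosDef) :
    Complex.log A.det = (Real.log A.det.re : ℂ) := by
  obtain ⟨hre, him⟩ := Complex.pos_iff.mp hA.det_pos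
  rw [Complex.ofReal_log hre.le]
  congr 1
  exact Complex.ext rfl him.symm

theorem Matrix.PosDef.hasDerivAt_log_det_segment {m : Type*} [Fintype m] [DecidableEq m]
    {A B : Matrix m m ℂ} (hA : A.PosDef) (hB : B.PosDef) {t : ℝ}
    (ht : t ∈ Set.Icc (0 : ℝ) 1) :
    HasDerivAt (fun s : ℝ => Complex.log ((s : ℂ) • A + ((1 - s : ℝ) : ℂ) • B).det)
      (((t : ℂ) • A + ((1 - t : ℝ) : ℂ) • B)⁻¹ * (A - B)).trace t := by
  have hpos := (hA.segment hB ht).det_pos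
  push_cast at hpos ⊢
  have h := (Matrix.hasDerivAt_det_segment A B hpos.ne'.isUnit).comp_ofReal.clog_real
    (Or.inl (Complex.pos_iff.mp hpos).1)
  rwa [mul_div_cancel_left₀ _ hpos.ne'] at h

theorem Matrix.PosDef.continuousOn_inv_segment {m : Type*} [Fintype m] [DecidableEq m]
    {A B : Matrix m m ℂ} (hA : A.PosDef) (hB : B.PosDef) :
    ContinuousOn (fun t : ℝ => ((t : ℂ) • A + ((1 - t : ℝ) : ℂ) • B)⁻¹) (Set.Icc 0 1) := by
  have hS : Continuous fun t : ℝ => (t : ℂ) • A + ((1 - t : ℝ) : ℂ) • B := by fun_prop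
  simp_rw [Matrix.inv_def, Ring.inverse_eq_inv']
  exact (hS.matrix_det.continuousOn.inv₀ fun t ht => (hA.segment hB ht).det_pos.ne').smul
    hS.matrix_adjugate.continuousOn

/-- **Integral formula for the difference of log-determinants.**
If `A` and `B` are `n × n` Hermitian positive definite matrices and
`M = ∫₀¹ (t·A + (1−t)·B)⁻¹ dt` (entrywise integral), then
`log det A − log det B = Σ_{i,j} M_{j i} (A − B)_{i j} = trace (M * (A − B))`. -/
theorem logDet_sub_eq_trace_integral_inv_mul
    (n : ℕ) (A B : Matrix (Fin n) (Fin n) ℂ) (hA : A.PosDef) (hB : B.PosDef)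
    (M : Matrix (Fin n) (Fin n) ℂ)
    (hM : ∀ i j, M i j = ∫ t in (0:ℝ)..1, (((t : ℂ) • A + ((1 - t : ℝ) : ℂ) • B)⁻¹) i j) :
    (∑ i, ∑ j, M j i * (A - B) i j)
        = ((Real.log A.det.re - Real.log B.det.re : ℝ) : ℂ) ∧
      Matrix.trace (M * (A - B))
        = ((Real.log A.det.re - Real.log B.det.re : ℝ) : ℂ) := by
  have hint (i j : Fin n) : IntervalIntegrable
      (fun t : ℝ => (((t : ℂ) • A + ((1 - t : ℝ) : ℂ) • B)⁻¹) i j) MeasureTheory.volume 0 1 := by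
    refine ContinuousOn.intervalIntegrable ?_
    rw [Set.uIcc_of_le zero_le_one]
    exact (continuous_id.matrix_elem i j).comp_continuousOn (hA.continuousOn_inv_segment hB)
  have hterm (i j : Fin n) : IntervalIntegrable
      (fun t : ℝ => (((t : ℂ) • A + ((1 - t : ℝ) : ℂ) • B)⁻¹) i j * (A - B) j i)
      MeasureTheory.volume 0 1 := (hint i j).mul_const _
  have hrow (i : Fin n) : IntervalIntegrable
      (fun t : ℝ => ∑ j, (((t : ℂ) • A + ((1 - t : ℝ) : ℂ) • B)⁻¹) i j * (A - B) j i)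
      MeasureTheory.volume 0 1 := by
    simpa only [Finset.sum_fn] using IntervalIntegrable.sum Finset.univ fun j _ => hterm i j
  have htrace : (M * (A - B)).trace =
      ∫ t in (0:ℝ)..1, (((t : ℂ) • A + ((1 - t : ℝ) : ℂ) • B)⁻¹ * (A - B)).trace := by
    simp only [Matrix.trace, Matrix.diag, Matrix.mul_apply, hM]
    rw [intervalIntegral.integral_finsetSum fun i _ => hrow i]
    refine Finset.sum_congr rfl fun i _ => ?_
    rw [intervalIntegral.integral_finsetSum fun j _ => hterm i j]
    simp_rw [intervalIntegral.integral_mul_const]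
  have hmain : (M * (A - B)).trace
      = ((Real.log A.det.re - Real.log B.det.re : ℝ) : ℂ) := by
    have htrint : IntervalIntegrable
        (fun t : ℝ => (((t : ℂ) • A + ((1 - t : ℝ) : ℂ) • B)⁻¹ * (A - B)).trace)
        MeasureTheory.volume 0 1 := by
      simp only [Matrix.trace, Matrix.diag, Matrix.mul_apply]
      simpa only [Finset.sum_fn] using IntervalIntegrable.sum Finset.univ fun i _ => hrow i
    rw [htrace, intervalIntegral.integral_eq_sub_of_hasDerivAt (fun t ht =>
      hA.hasDerivAt_log_det_segment hB (by rwa [Set.uIcc_of_le zero_le_one] at ht)) htrint]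
    simp [hA.log_det_eq_ofReal, hB.log_det_eq_ofReal]
  refine ⟨?_, hmain⟩
  rw [← hmain, Finset.sum_comm]
  simp [Matrix.trace, Matrix.mul_apply]
end
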